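/- (Littlewood's gap estimate) Assume the Riemann hypothesis. Then there exists A > 0 such that for every sufficiently large γ' > 0 with ζ(1/2 + iγ') = 0 there exists γ'' with γ' < γ'' < γ' + A/ln(ln γ') and ζ(1/2 + iγ'') = 0. -/

import Mathlib

open Filter Topology

lemma norm_natCast_cpow_sub_cpow_le {n : ℕ} (hn : 0 < n) {s : ℂ} (hs : 0 < s.re) {x : ℝ}
    (hx : x ∈ Set.Icc (n : ℝ) (n + 1)) :
    ‖((n : ℝ) : ℂ) ^ (-s) - (x : ℂ) ^ (-s)‖ ≤ ‖s‖ * (n : ℝ) ^ (-s.re - 1) := by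
  have hn' : (0 : ℝ) < n := by exact_mod_cast hn
  have hs0 : s ≠ 0 := fun h ↦ by simp [h] at hs
  have key := norm_image_sub_le_of_norm_deriv_le_segment'
    (f := fun y : ℝ ↦ (y : ℂ) ^ (-s)) (f' := fun y : ℝ ↦ -s * (y : ℂ) ^ (-s - 1))
    (a := n) (b := x) (C := ‖s‖ * (n : ℝ) ^ (-s.re - 1)) (fun y hy ↦ ?_) (fun y hy ↦ ?_)
    x ⟨hx.1, le_rfl⟩
  · rw [norm_sub_rev]
    refine key.trans (mul_le_of_le_one_right (by positivity) (by linarith [hx.2]))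
  · have hy0 : 0 < y := hn'.trans_le hy.1
    exact (hasDerivAt_ofReal_cpow_const hy0.ne' (neg_ne_zero.2 hs0)).hasDerivWithinAt
  · have hy0 : 0 < y := hn'.trans_le hy.1
    rw [norm_mul, norm_neg, Complex.norm_cpow_eq_rpow_re_of_pos hy0]
    refine mul_le_mul_of_nonneg_left ?_ (norm_nonneg _)
    have : (-s - 1).re = -s.re - 1 := by simp
    rw [this]
    exact Real.rpow_le_rpow_of_nonpos hn' hy.1 (by linarith)

/-- The `n`-th term of a series for `(s - 1) ζ(s)` that converges on `0 < re s`. -/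
noncomputable def zetaTerm (n : ℕ) (s : ℂ) : ℂ :=
  (s - 1) * ((n + 1 : ℕ) : ℂ) ^ (-s) - ((n + 1 : ℕ) : ℂ) ^ (1 - s) + ((n + 2 : ℕ) : ℂ) ^ (1 - s)

lemma differentiable_zetaTerm (n : ℕ) : Differentiable ℂ (zetaTerm n) := by
  have h1 : ((n + 1 : ℕ) : ℂ) ≠ 0 := by exact_mod_cast Nat.succ_ne_zero n
  have h2 : ((n + 2 : ℕ) : ℂ) ≠ 0 := by exact_mod_cast Nat.succ_ne_zero (n + 1)
  have hc (m : ℂ) (hm : m ≠ 0) (f : ℂ → ℂ) (hf : Differentiable ℂ f) :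
      Differentiable ℂ (fun s ↦ m ^ f s) := fun s ↦ (hf s).const_cpow (Or.inl hm)
  unfold zetaTerm
  exact (((differentiable_id.sub_const 1).mul (hc _ h1 _ differentiable_id.neg)).sub
    (hc _ h1 _ (differentiable_id.const_sub 1))).add (hc _ h2 _ (differentiable_id.const_sub 1))

lemma norm_zetaTerm_le (n : ℕ) {s : ℂ} (hs : 0 < s.re) :
    ‖zetaTerm n s‖ ≤ ‖s - 1‖ * ‖s‖ * ((n + 1 : ℕ) : ℝ) ^ (-s.re - 1) := by
  have hn' : (0 : ℝ) < (n + 1 : ℕ) := by positivity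
  by_cases hs1 : s = 1
  · subst hs1; simp [zetaTerm]
  have key := norm_image_sub_le_of_norm_deriv_le_segment'
    (f := fun y : ℝ ↦ (s - 1) * ((n + 1 : ℕ) : ℂ) ^ (-s) * (y : ℂ) + (y : ℂ) ^ (1 - s))
    (f' := fun y : ℝ ↦ (s - 1) * ((((n + 1 : ℕ) : ℝ) : ℂ) ^ (-s) - (y : ℂ) ^ (-s)))
    (a := (n + 1 : ℕ)) (b := (n + 1 : ℕ) + 1)
    (C := ‖s - 1‖ * ‖s‖ * ((n + 1 : ℕ) : ℝ) ^ (-s.re - 1)) (fun y hy ↦ ?_) (fun y hy ↦ ?_)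
    ((n + 1 : ℕ) + 1) ⟨by linarith, le_rfl⟩
  · convert key using 1
    · unfold zetaTerm
      congr 1
      push_cast
      ring_nf
    · ring
  · have hy0 : 0 < y := hn'.trans_le hy.1
    have h1 := hasDerivAt_ofReal_cpow_const hy0.ne' (sub_ne_zero.2 (Ne.symm hs1))
    have h2 := ((hasDerivAt_id (y : ℝ)).ofReal_comp).const_mul
      ((s - 1) * ((n + 1 : ℕ) : ℂ) ^ (-s))
    refine HasDerivAt.hasDerivWithinAt ?_
    refine (h2.add h1).congr_deriv ?_
    rw [show (1 - s - 1) = -s by ring]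
    push_cast
    ring
  · rw [norm_mul, mul_assoc]
    exact mul_le_mul_of_nonneg_left
      (norm_natCast_cpow_sub_cpow_le n.succ_pos hs ⟨hy.1, hy.2.le⟩) (norm_nonneg _)

lemma hasSum_zetaTerm_of_one_lt_re {s : ℂ} (hs : 1 < s.re) :
    HasSum (fun n ↦ zetaTerm n s) ((s - 1) * riemannZeta s - 1) := by
  have h1 : HasSum (fun n : ℕ ↦ (s - 1) * ((n + 1 : ℕ) : ℂ) ^ (-s)) ((s - 1) * riemannZeta s) := by
    refine HasSum.mul_left _ ?_
    rw [zeta_eq_tsum_one_div_nat_add_one_cpow hs]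
    have : Summable (fun n : ℕ ↦ 1 / ((n : ℂ) + 1) ^ s) := by
      have := (summable_nat_add_iff 1).2 (Complex.summable_one_div_nat_cpow.2 hs)
      simpa using this
    refine this.hasSum.congr_fun fun n ↦ ?_
    rw [Complex.cpow_neg]; push_cast; simp
  have h2 : HasSum (fun n : ℕ ↦ -(((n + 1 : ℕ) : ℂ) ^ (1 - s)) + ((n + 2 : ℕ) : ℂ) ^ (1 - s))
      (-1) := by
    have hsum : Summable (fun n : ℕ ↦
        -(((n + 1 : ℕ) : ℂ) ^ (1 - s)) + ((n + 2 : ℕ) : ℂ) ^ (1 - s)) := by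
      have hz : Summable (fun n : ℕ ↦ zetaTerm n s) := by
        refine Summable.of_norm_bounded (g := fun n : ℕ ↦
          ‖s - 1‖ * ‖s‖ * ((n + 1 : ℕ) : ℝ) ^ (-s.re - 1)) ?_
          (fun n ↦ norm_zetaTerm_le n (by linarith))
        refine Summable.mul_left _ ?_
        exact (summable_nat_add_iff 1).2 (Real.summable_nat_rpow.2 (by linarith))
      refine (hz.sub h1.summable).congr fun n ↦ ?_
      unfold zetaTerm; ring
    refine (hsum.hasSum_iff_tendsto_nat).2 ?_
    have ht : Tendsto (fun n : ℕ ↦ ((n + 1 : ℕ) : ℂ) ^ (1 - s) - 1) atTop (𝓝 (0 - 1)) := by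
      refine Tendsto.sub_const ?_ 1
      rw [tendsto_zero_iff_norm_tendsto_zero]
      have : Tendsto (fun n : ℕ ↦ ((n + 1 : ℕ) : ℝ) ^ (-(s.re - 1))) atTop (𝓝 0) :=
        (tendsto_rpow_neg_atTop (by linarith)).comp
          (tendsto_natCast_atTop_atTop.comp (tendsto_add_atTop_nat 1))
      refine this.congr fun n ↦ ?_
      rw [Complex.norm_natCast_cpow_of_pos n.succ_pos]
      simp
    rw [zero_sub] at ht
    refine ht.congr fun n ↦ ?_
    induction n with
    | zero => simp
    | succ k ih => rw [Finset.sum_range_succ, ← ih]; push_cast; ring_nf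
  rw [sub_eq_add_neg _ (1 : ℂ)]
  refine (h1.add h2).congr_fun fun n ↦ ?_
  unfold zetaTerm; ring

lemma riemannZeta₁_eq_tsum {s : ℂ} (hs : 0 < s.re) :
    riemannZeta₁ s = 1 + ∑' n, zetaTerm n s := by
  set U : Set ℂ := {z | s.re / 2 < z.re} ∩ Metric.ball 0 (‖s‖ + 3) with hU
  have hUo : IsOpen U := (isOpen_lt continuous_const Complex.continuous_re).inter Metric.isOpen_ball
  have hUc : Convex ℝ U := (convex_halfSpace_re_gt _).inter (convex_ball _ _)
  have hsU : s ∈ U := ⟨by simp; linarith, by simp⟩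
  have h2 : (2 + s.re : ℂ) ∈ U := by
    refine ⟨by simp; linarith, ?_⟩
    rw [mem_ball_zero_iff]
    calc ‖(2 + s.re : ℂ)‖ ≤ ‖(2 : ℂ)‖ + ‖(s.re : ℂ)‖ := norm_add_le _ _
      _ ≤ 2 + ‖s‖ := by
        simp only [Complex.norm_ofNat, Complex.norm_real, Real.norm_eq_abs]
        linarith [Complex.abs_re_le_norm s]
      _ < _ := by linarith
  have hd : DifferentiableOn ℂ (fun z ↦ 1 + ∑' n, zetaTerm n z) U := by
    refine DifferentiableOn.const_add _ ?_
    refine Complex.differentiableOn_tsum_of_summable_norm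
      (u := fun n : ℕ ↦ (‖s‖ + 4) * (‖s‖ + 3) * ((n + 1 : ℕ) : ℝ) ^ (-(s.re / 2) - 1)) ?_
      (fun n ↦ (differentiable_zetaTerm n).differentiableOn) hUo (fun n z hz ↦ ?_)
    · refine Summable.mul_left _ ?_
      exact (summable_nat_add_iff 1).2 (Real.summable_nat_rpow.2 (by linarith))
    · have hz1 : s.re / 2 < z.re := hz.1
      have hz2 : ‖z‖ < ‖s‖ + 3 := by simpa using hz.2
      refine (norm_zetaTerm_le n (by linarith)).trans ?_
      have hz3 : ‖z - 1‖ ≤ ‖s‖ + 4 := by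
        have := norm_sub_le z 1
        simp at this; linarith
      have : ((n + 1 : ℕ) : ℝ) ^ (-z.re - 1) ≤ ((n + 1 : ℕ) : ℝ) ^ (-(s.re / 2) - 1) :=
        Real.rpow_le_rpow_of_exponent_le (by simp) (by linarith)
      gcongr
  have hz : DifferentiableOn ℂ riemannZeta₁ U := differentiable_riemannZeta₁.differentiableOn
  refine (hz.analyticOnNhd hUo).eqOn_of_preconnected_of_eventuallyEq
    (hd.analyticOnNhd hUo) hUc.isPreconnected h2 ?_ hsU
  have : {z : ℂ | 1 < z.re} ∈ 𝓝 (2 + s.re : ℂ) :=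
    (isOpen_lt continuous_const Complex.continuous_re).mem_nhds (by simp; linarith)
  filter_upwards [this] with z hz
  have hz1 : z ≠ 1 := fun h ↦ by simp [h] at hz
  rw [(hasSum_zetaTerm_of_one_lt_re hz).tsum_eq, riemannZeta_eq_inv_sub_mul hz1]
  field_simp [sub_ne_zero.2 hz1]
  ring

/-- Polynomial growth of `ζ` to the right of the line `re s = 1/10`. -/
lemma exists_norm_riemannZeta_le :
    ∃ C : ℝ, 1 ≤ C ∧ ∀ s : ℂ, 1 / 10 ≤ s.re → 1 ≤ |s.im| → ‖riemannZeta s‖ ≤ C * ‖s‖ := by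
  have hsum : Summable fun n : ℕ ↦ ((n + 1 : ℕ) : ℝ) ^ (-(1 / 10 : ℝ) - 1) :=
    (summable_nat_add_iff 1).2 (Real.summable_nat_rpow.2 (by norm_num))
  set S := ∑' n : ℕ, ((n + 1 : ℕ) : ℝ) ^ (-(1 / 10 : ℝ) - 1) with hS
  have hS0 : 0 ≤ S := tsum_nonneg fun n ↦ by positivity
  refine ⟨1 + S, by linarith, fun s hs hi ↦ ?_⟩
  have h1 : s ≠ 1 := fun h ↦ by simp [h] at hi; linarith
  have hn1 : 1 ≤ ‖s - 1‖ := by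
    have := Complex.abs_im_le_norm (s - 1)
    simp at this; linarith
  have hn2 : 1 ≤ ‖s‖ := hi.trans (Complex.abs_im_le_norm s)
  have hb (n : ℕ) : ‖zetaTerm n s‖ ≤
      ‖s - 1‖ * ‖s‖ * ((n + 1 : ℕ) : ℝ) ^ (-(1 / 10 : ℝ) - 1) := by
    refine (norm_zetaTerm_le n (by linarith)).trans ?_
    have : ((n + 1 : ℕ) : ℝ) ^ (-s.re - 1) ≤ ((n + 1 : ℕ) : ℝ) ^ (-(1 / 10 : ℝ) - 1) :=
      Real.rpow_le_rpow_of_exponent_le (by simp) (by linarith)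
    gcongr
  have ht : ‖∑' n, zetaTerm n s‖ ≤ ‖s - 1‖ * ‖s‖ * S :=
    tsum_of_norm_bounded (hsum.hasSum.mul_left _) hb
  rw [riemannZeta_eq_inv_sub_mul h1, riemannZeta₁_eq_tsum (by linarith), norm_mul, norm_inv,
    inv_mul_le_iff₀ (by linarith)]
  calc ‖1 + ∑' n, zetaTerm n s‖ ≤ 1 + ‖s - 1‖ * ‖s‖ * S := by
        refine (norm_add_le _ _).trans ?_
        simpa using ht
    _ ≤ ‖s - 1‖ * ((1 + S) * ‖s‖) := by nlinarith [mul_le_mul hn1 hn2 zero_le_one (by linarith)]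

section LocalFactorization

open Metric

/-- `R₀² - conj ρ z`, divided by `R₀`, has the same modulus as `z - ρ` on the circle of
radius `R₀`. -/
noncomputable def blaschkeDenom (R₀ : ℝ) (ρ z : ℂ) : ℂ := (R₀ ^ 2 - (starRingEnd ℂ) ρ * z) / R₀

lemma norm_blaschkeDenom_of_norm_eq {R₀ : ℝ} (hR₀ : 0 < R₀) (ρ : ℂ) {z : ℂ} (hz : ‖z‖ = R₀) :
    ‖blaschkeDenom R₀ ρ z‖ = ‖z - ρ‖ := by
  have h1 : ((R₀ : ℂ) ^ 2 - (starRingEnd ℂ) ρ * z) = z * (starRingEnd ℂ) (z - ρ) := by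
    rw [map_sub, mul_sub, Complex.mul_conj, Complex.normSq_eq_norm_sq, hz]
    push_cast; ring
  rw [blaschkeDenom, h1, norm_div, norm_mul, RCLike.norm_conj, hz, Complex.norm_real,
    Real.norm_of_nonneg hR₀.le]
  field_simp

lemma le_norm_sq_sub_conj_mul {R R₀ : ℝ} {ρ z : ℂ} (hρ : ‖ρ‖ ≤ R)
    (hz : ‖z‖ ≤ R) : R₀ ^ 2 - R ^ 2 ≤ ‖(R₀ : ℂ) ^ 2 - (starRingEnd ℂ) ρ * z‖ := by
  have h1 : ‖(R₀ : ℂ) ^ 2‖ - ‖(starRingEnd ℂ) ρ * z‖ ≤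
    ‖(R₀ : ℂ) ^ 2 - (starRingEnd ℂ) ρ * z‖ := norm_sub_norm_le _ _
  have h2 : ‖(starRingEnd ℂ) ρ * z‖ ≤ R ^ 2 := by
    rw [norm_mul, RCLike.norm_conj, sq]
    exact mul_le_mul hρ hz (norm_nonneg _) ((norm_nonneg _).trans hρ)
  have h3 : ‖(R₀ : ℂ) ^ 2‖ = R₀ ^ 2 := by
    rw [norm_pow, Complex.norm_real, Real.norm_eq_abs, sq_abs]
  linarith

lemma differentiable_blaschkeDenom (R₀ : ℝ) (ρ : ℂ) : Differentiable ℂ (blaschkeDenom R₀ ρ) := by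
  unfold blaschkeDenom
  fun_prop

lemma norm_le_of_eq_prod_mul {R₀ R₁ M : ℝ} (hR₀ : 0 < R₀) (hR₁ : R₀ < R₁) {f g : ℂ → ℂ} {N : ℕ}
    {ρ : Fin N → ℂ} (hg : DifferentiableOn ℂ g (ball 0 R₁))
    (hfg : ∀ z ∈ ball (0 : ℂ) R₁, f z = (∏ i, (z - ρ i)) * g z)
    (hf : ∀ z ∈ closedBall (0 : ℂ) R₀, ‖f z‖ ≤ M) {z : ℂ} (hz : z ∈ closedBall (0 : ℂ) R₀) :
    ‖(∏ i, blaschkeDenom R₀ (ρ i) z) * g z‖ ≤ M := by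
  have hd : DifferentiableOn ℂ (fun z ↦ (∏ i, blaschkeDenom R₀ (ρ i) z) * g z) (ball 0 R₁) := by
    refine DifferentiableOn.mul ?_ hg
    exact (Differentiable.fun_finsetProd fun i _ ↦
      differentiable_blaschkeDenom R₀ (ρ i)).differentiableOn
  refine Complex.norm_le_of_forall_mem_frontier_norm_le (U := ball 0 R₀)
    (f := fun z ↦ (∏ i, blaschkeDenom R₀ (ρ i) z) * g z) isBounded_ball ?_ ?_ ?_
  · refine DifferentiableOn.diffContOnCl ?_
    rw [closure_ball _ hR₀.ne']
    exact hd.mono (closedBall_subset_ball hR₁)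
  · intro w hw
    rw [frontier_ball _ hR₀.ne', mem_sphere_zero_iff_norm] at hw
    have hw1 : w ∈ ball (0 : ℂ) R₁ := by simpa [hw] using hR₁
    have hw2 : w ∈ closedBall (0 : ℂ) R₀ := by simp [hw]
    refine le_trans (le_of_eq ?_) (hf w hw2)
    rw [hfg w hw1, norm_mul, norm_mul, norm_prod, norm_prod]
    congr 1
    exact Finset.prod_congr rfl fun i _ ↦ norm_blaschkeDenom_of_norm_eq hR₀ _ hw
  · rwa [closure_ball _ hR₀.ne']

lemma card_zeros_le {R R₀ R₁ : ℝ} (hR : 0 < R) (hRR₀ : R < R₀) (hR₁ : R₀ < R₁) {Λ : ℝ}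
    {f g : ℂ → ℂ} {N : ℕ} {ρ : Fin N → ℂ} (hg : DifferentiableOn ℂ g (ball 0 R₁))
    (hfg : ∀ z ∈ ball (0 : ℂ) R₁, f z = (∏ i, (z - ρ i)) * g z)
    (hf : ∀ z ∈ closedBall (0 : ℂ) R₀, ‖f z‖ ≤ Real.exp Λ) (hf0 : Real.exp (-Λ) ≤ ‖f 0‖)
    (hρ : ∀ i, ‖ρ i‖ ≤ R) :
    (N : ℝ) ≤ 2 * Λ / Real.log (R₀ / R) ∧
      Real.exp (-Λ) ≤ ‖(∏ i, blaschkeDenom R₀ (ρ i) 0) * g 0‖ := by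
  have hR₀ : 0 < R₀ := hR.trans hRR₀
  have h1 := norm_le_of_eq_prod_mul hR₀ hR₁ hg hfg hf (z := 0) (by simp [hR₀.le])
  have h2 : ‖∏ i, blaschkeDenom R₀ (ρ i) 0‖ = R₀ ^ N := by
    rw [norm_prod]
    have (i : Fin N) : ‖blaschkeDenom R₀ (ρ i) 0‖ = R₀ := by
      simp only [blaschkeDenom, mul_zero, sub_zero]
      rw [norm_div, norm_pow, Complex.norm_real, Real.norm_of_nonneg hR₀.le]
      field_simp
    simp [this]
  have h3 : ‖f 0‖ ≤ R ^ N * ‖g 0‖ := by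
    rw [hfg 0 (by simp [hR₀.trans hR₁]), norm_mul, norm_prod]
    gcongr
    calc ∏ i, ‖0 - ρ i‖ ≤ ∏ _i : Fin N, R :=
          Finset.prod_le_prod (fun _ _ ↦ norm_nonneg _) fun i _ ↦ by simpa using hρ i
      _ = R ^ N := by simp
  rw [norm_mul, h2] at h1
  have h4 : (R₀ / R) ^ N * ‖f 0‖ ≤ R₀ ^ N * ‖g 0‖ := by
    calc (R₀ / R) ^ N * ‖f 0‖ ≤ (R₀ / R) ^ N * (R ^ N * ‖g 0‖) := by gcongr
      _ = R₀ ^ N * ‖g 0‖ := by rw [div_pow]; field_simp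
  have hlog : 0 < Real.log (R₀ / R) := Real.log_pos ((one_lt_div hR).2 hRR₀)
  constructor
  · rw [le_div_iff₀ hlog]
    have h5 : (R₀ / R) ^ N * Real.exp (-Λ) ≤ Real.exp Λ :=
      (mul_le_mul_of_nonneg_left hf0 (by positivity)).trans (h4.trans h1)
    have h6 : (R₀ / R) ^ N ≤ Real.exp (2 * Λ) := by
      rw [Real.exp_neg, ← div_eq_mul_inv, div_le_iff₀ (Real.exp_pos _), ← Real.exp_add] at h5
      rw [two_mul]; exact h5
    have h7 := Real.log_le_log (by positivity) h6
    rwa [Real.log_exp, Real.log_pow] at h7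
  · rw [norm_mul, h2]
    refine hf0.trans (le_trans ?_ h4)
    refine le_mul_of_one_le_left (norm_nonneg _) (one_le_pow₀ ?_)
    exact ((one_lt_div hR).2 hRR₀).le

lemma norm_logDeriv_le_of_norm_le {r R Λ : ℝ} (hr : 0 < r) (hrR : r < R) (hΛ : 0 < Λ)
    {q : ℂ → ℂ} (hq : DifferentiableOn ℂ q (ball 0 R)) (hq0 : ∀ z ∈ ball (0 : ℂ) R, q z ≠ 0)
    (hqM : ∀ z ∈ ball (0 : ℂ) R, ‖q z‖ ≤ Real.exp Λ) (hqc : Real.exp (-Λ) ≤ ‖q 0‖)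
    {z : ℂ} (hz : ‖z‖ ≤ r) :
    ‖logDeriv q z‖ ≤ 16 * R / (R - r) ^ 2 * Λ := by
  have hR : 0 < R := hr.trans hrR
  have h0 : (0 : ℂ) ∈ ball (0 : ℂ) R := by simp [hR]
  have hld : DifferentiableOn ℂ (logDeriv q) (ball 0 R) := by
    have := (hq.deriv isOpen_ball).div hq hq0
    exact this
  obtain ⟨F, hF0, hF⟩ := hld.isExactOn_ball.with_val_at 0 0
  have hFd : DifferentiableOn ℂ F (ball 0 R) := fun w hw ↦
    (hF w hw).differentiableAt.differentiableWithinAt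
  have hqF (w : ℂ) (hw : w ∈ ball (0 : ℂ) R) : q w * Complex.exp (-F w) = q 0 := by
    have hd (u : ℂ) (hu : u ∈ ball (0 : ℂ) R) :
        HasDerivAt (fun w ↦ q w * Complex.exp (-F w)) 0 u := by
      have h1 := ((hq u hu).differentiableAt (isOpen_ball.mem_nhds hu)).hasDerivAt
      have h2 := h1.mul (hF u hu).neg.cexp
      refine h2.congr_deriv ?_
      rw [logDeriv_apply]
      field_simp [hq0 u hu]
      ring
    have := isOpen_ball.is_const_of_deriv_eq_zero (convex_ball (0 : ℂ) R).isPreconnected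
      (f := fun w ↦ q w * Complex.exp (-F w))
      (fun u hu ↦ (hd u hu).differentiableAt.differentiableWithinAt)
      (fun u hu ↦ (hd u hu).deriv) hw h0
    simpa [hF0] using this
  have hre : Set.MapsTo F (ball 0 R) {z | z.re ≤ 2 * Λ} := by
    intro w hw
    have h1 := congrArg norm (hqF w hw)
    rw [norm_mul, Complex.norm_exp, Complex.neg_re] at h1
    have h2 : Real.exp (-Λ) ≤ Real.exp Λ * Real.exp (-(F w).re) := by
      rw [← h1] at hqc
      exact hqc.trans (mul_le_mul_of_nonneg_right (hqM w hw) (Real.exp_pos _).le)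
    rw [← Real.exp_add, Real.exp_le_exp] at h2
    simp only [Set.mem_ofPred_eq]
    linarith
  have hzR : z ∈ ball (0 : ℂ) R := by simpa using hz.trans_lt hrR
  have hder : deriv F z = logDeriv q z := (hF z hzR).deriv
  rw [← hder]
  have hδ : 0 < (R - r) / 2 := by linarith
  have hsub : closedBall z ((R - r) / 2) ⊆ ball (0 : ℂ) R := by
    intro w hw
    rw [mem_closedBall_iff_norm] at hw
    rw [mem_ball_zero_iff]
    calc ‖w‖ = ‖(w - z) + z‖ := by ring_nf
      _ ≤ ‖w - z‖ + ‖z‖ := norm_add_le _ _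
      _ < R := by linarith
  have := Complex.norm_deriv_le_of_forall_mem_sphere_norm_le (c := z) (f := F) hδ
    (C := 8 * R / (R - r) * Λ)
    (DifferentiableOn.diffContOnCl (by
      rw [closure_ball _ hδ.ne']; exact hFd.mono hsub)) ?_
  · refine this.trans (le_of_eq ?_)
    have : R - r ≠ 0 := by linarith
    field_simp
    ring
  · intro w hw
    have hwR : w ∈ ball (0 : ℂ) R := hsub (sphere_subset_closedBall hw)
    refine (Complex.borelCaratheodory_zero (by linarith) hFd hre hR hwR hF0).trans ?_
    have hw' : ‖w‖ ≤ (R + r) / 2 := by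
      rw [mem_sphere_iff_norm] at hw
      calc ‖w‖ = ‖(w - z) + z‖ := by ring_nf
        _ ≤ ‖w - z‖ + ‖z‖ := norm_add_le _ _
        _ ≤ _ := by linarith
    calc 2 * (2 * Λ) * ‖w‖ / (R - ‖w‖) ≤ 2 * (2 * Λ) * R / ((R - r) / 2) := by
          gcongr <;> linarith
      _ = 8 * R / (R - r) * Λ := by
          have : R - r ≠ 0 := by linarith
          field_simp; ring

lemma norm_logDeriv_prod_blaschkeDenom_le {R R₀ : ℝ} (hR : 0 < R) (hRR₀ : R < R₀) {N : ℕ}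
    {ρ : Fin N → ℂ} (hρ : ∀ i, ‖ρ i‖ ≤ R) {z : ℂ} (hz : ‖z‖ ≤ R) :
    (∏ i, blaschkeDenom R₀ (ρ i) z) ≠ 0 ∧
    ‖logDeriv (fun z ↦ ∏ i, blaschkeDenom R₀ (ρ i) z) z‖ ≤ N * (R / (R₀ ^ 2 - R ^ 2)) := by
  have hR₀ : 0 < R₀ := hR.trans hRR₀
  have hpos : 0 < R₀ ^ 2 - R ^ 2 := by nlinarith
  have hle (i : Fin N) := le_norm_sq_sub_conj_mul (R₀ := R₀) (hρ i) hz
  have hne' (i : Fin N) : (R₀ : ℂ) ^ 2 - (starRingEnd ℂ) (ρ i) * z ≠ 0 :=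
    norm_pos_iff.1 (hpos.trans_le (hle i))
  have hR₀c : (R₀ : ℂ) ≠ 0 := by exact_mod_cast hR₀.ne'
  have hne (i : Fin N) : blaschkeDenom R₀ (ρ i) z ≠ 0 := div_ne_zero (hne' i) hR₀c
  refine ⟨Finset.prod_ne_zero_iff.2 fun i _ ↦ hne i, ?_⟩
  rw [logDeriv_prod (fun i _ ↦ hne i) (fun i _ ↦ differentiable_blaschkeDenom R₀ (ρ i) z)]
  refine (norm_sum_le _ _).trans ?_
  have hb (i : Fin N) : ‖logDeriv (blaschkeDenom R₀ (ρ i)) z‖ ≤ R / (R₀ ^ 2 - R ^ 2) := by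
    have hd : HasDerivAt (blaschkeDenom R₀ (ρ i)) (-(starRingEnd ℂ) (ρ i) / R₀) z := by
      exact ((((hasDerivAt_id z).const_mul ((starRingEnd ℂ) (ρ i))).const_sub
        ((R₀ : ℂ) ^ 2)).div_const (R₀ : ℂ)).congr_deriv (by simp)
    rw [logDeriv_apply, hd.deriv, blaschkeDenom, div_div_div_cancel_right₀ hR₀c, norm_div,
      norm_neg, RCLike.norm_conj]
    exact div_le_div₀ hR.le (hρ i) hpos (hle i)
  refine (Finset.sum_le_sum fun i _ ↦ hb i).trans ?_
  simp

/-- A holomorphic function of controlled size is, on a smaller disc, a polynomial times a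
zero-free function with controlled logarithmic derivative. -/
theorem exists_local_factorization {r R R₀ R₁ : ℝ} (hr : 0 < r) (hrR : r < R) (hRR₀ : R < R₀)
    (hR₁ : R₀ < R₁) :
    ∃ C : ℝ, 0 < C ∧ ∀ (f : ℂ → ℂ) (Λ : ℝ), 1 ≤ Λ → DifferentiableOn ℂ f (ball 0 R₁) →
      (∀ z ∈ closedBall (0 : ℂ) R₀, ‖f z‖ ≤ Real.exp Λ) → Real.exp (-Λ) ≤ ‖f 0‖ →
      ∃ (N : ℕ) (ρ : Fin N → ℂ) (g : ℂ → ℂ), (∀ i, ‖ρ i‖ ≤ R) ∧ (∀ i, f (ρ i) = 0) ∧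
        DifferentiableOn ℂ g (ball 0 R₁) ∧
        (∀ z ∈ ball (0 : ℂ) R₁, f z = (∏ i, (z - ρ i)) * g z) ∧
        (∀ z ∈ closedBall (0 : ℂ) R, g z ≠ 0) ∧ (N : ℝ) ≤ C * Λ ∧
        ∀ z ∈ closedBall (0 : ℂ) r, ‖logDeriv g z‖ ≤ C * Λ := by
  have hR : 0 < R := hr.trans hrR
  have hR₀ : 0 < R₀ := hR.trans hRR₀
  have hlog : 0 < Real.log (R₀ / R) := Real.log_pos ((one_lt_div hR).2 hRR₀)
  have hpos : 0 < R₀ ^ 2 - R ^ 2 := by nlinarith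
  set κ := 2 / Real.log (R₀ / R) with hκ
  have hκ0 : 0 < κ := by positivity
  set B := 16 * R / (R - r) ^ 2 with hB
  have hB0 : 0 < B := by
    have : 0 < R - r := by linarith
    positivity
  set D := R / (R₀ ^ 2 - R ^ 2) with hD
  have hD0 : 0 < D := by positivity
  refine ⟨κ + B + κ * D, by positivity, fun f Λ hΛ hf hfM hf0 ↦ ?_⟩
  have hΛ0 : 0 < Λ := by linarith
  let P : ℕ → Prop := fun N ↦ ∃ (ρ : Fin N → ℂ) (g : ℂ → ℂ), (∀ i, ‖ρ i‖ ≤ R) ∧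
    DifferentiableOn ℂ g (ball 0 R₁) ∧ ∀ z ∈ ball (0 : ℂ) R₁, f z = (∏ i, (z - ρ i)) * g z
  have hP0 : P 0 := ⟨Fin.elim0, f, fun i ↦ i.elim0, hf, fun z _ ↦ by simp⟩
  have hPb (N : ℕ) (h : P N) : N ≤ ⌈2 * Λ / Real.log (R₀ / R)⌉₊ := by
    obtain ⟨ρ, g, hρ, hg, hfg⟩ := h
    have := (card_zeros_le hR hRR₀ hR₁ hg hfg hfM hf0 hρ).1
    exact_mod_cast this.trans (Nat.le_ceil _)
  classical
  set N := Nat.findGreatest P ⌈2 * Λ / Real.log (R₀ / R)⌉₊ with hN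
  obtain ⟨ρ, g, hρ, hg, hfg⟩ : P N := Nat.findGreatest_spec (Nat.zero_le _) hP0
  have hmax : ¬ P (N + 1) := fun h ↦ by
    have := Nat.le_findGreatest (hPb _ h) h
    omega
  have hsub : closedBall (0 : ℂ) R ⊆ ball 0 R₁ := closedBall_subset_ball (hRR₀.trans hR₁)
  have hgne : ∀ z ∈ closedBall (0 : ℂ) R, g z ≠ 0 := by
    intro a ha h0
    refine hmax ⟨Fin.cons a ρ, dslope g a, ?_, ?_, ?_⟩
    · intro i
      refine Fin.cases ?_ (fun j ↦ ?_) i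
      · simpa using ha
      · simpa using hρ j
    · exact (Complex.differentiableOn_dslope (isOpen_ball.mem_nhds (hsub ha))).2 hg
    · intro z hz
      have := sub_smul_dslope g a z
      rw [h0, sub_zero, smul_eq_mul] at this
      rw [hfg z hz, ← this, Fin.prod_univ_succ]
      simp only [Fin.cons_zero, Fin.cons_succ]
      ring
  obtain ⟨hcard, hc⟩ := card_zeros_le hR hRR₀ hR₁ hg hfg hfM hf0 hρ
  have hcard' : (N : ℝ) ≤ κ * Λ := by rw [hκ]; convert hcard using 1; ring
  refine ⟨N, ρ, g, hρ, fun i ↦ ?_, hg, hfg, hgne, ?_, fun z hz ↦ ?_⟩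
  · rw [hfg _ (hsub (by simpa using hρ i)), Finset.prod_eq_zero (Finset.mem_univ i) (sub_self _),
      zero_mul]
  · refine hcard'.trans ?_
    gcongr
    have : 0 < κ * D := by positivity
    linarith
  · have hzr : ‖z‖ ≤ r := by simpa using hz
    have hzR : ‖z‖ ≤ R := hzr.trans hrR.le
    set b : ℂ → ℂ := fun z ↦ ∏ i, blaschkeDenom R₀ (ρ i) z with hb
    have hbd : Differentiable ℂ b :=
      Differentiable.fun_finsetProd fun i _ ↦ differentiable_blaschkeDenom R₀ (ρ i)
    obtain ⟨hbne, hbl⟩ := norm_logDeriv_prod_blaschkeDenom_le hR hRR₀ hρ hzR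
    have hq : ‖logDeriv (fun z ↦ b z * g z) z‖ ≤ B * Λ := by
      refine norm_logDeriv_le_of_norm_le hr hrR hΛ0 ?_ ?_ ?_ hc hzr
      · exact hbd.differentiableOn.mul (hg.mono (ball_subset_closedBall.trans hsub))
      · intro w hw
        exact mul_ne_zero (norm_logDeriv_prod_blaschkeDenom_le hR hRR₀ hρ
          (by simpa using (ball_subset_closedBall hw))).1 (hgne w (ball_subset_closedBall hw))
      · intro w hw
        exact norm_le_of_eq_prod_mul hR₀ hR₁ hg hfg hfM
          (closedBall_subset_closedBall hRR₀.le (ball_subset_closedBall hw))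
    have hzmem : z ∈ closedBall (0 : ℂ) R := by simpa using hzR
    have hmul := logDeriv_mul (f := b) (g := g) z hbne (hgne z hzmem) (hbd z)
      ((hg z (hsub hzmem)).differentiableAt (isOpen_ball.mem_nhds (hsub hzmem)))
    have : logDeriv g z = logDeriv (fun z ↦ b z * g z) z - logDeriv b z := by rw [hmul]; ring
    rw [this]
    calc ‖logDeriv (fun z ↦ b z * g z) z - logDeriv b z‖ ≤ B * Λ + N * D :=
          (norm_sub_le _ _).trans (add_le_add hq hbl)
      _ ≤ B * Λ + κ * Λ * D := by gcongr
      _ ≤ (κ + B + κ * D) * Λ := by nlinarith [mul_pos hκ0 hΛ0]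

end LocalFactorization

section Digamma

lemma abs_half_log_sub_sub_div_le {a y : ℝ} (ha : 0 ≤ a) (hy : 1 ≤ y) :
    |Real.log ((a + 1) ^ 2 + y ^ 2) / 2 - Real.log (a ^ 2 + y ^ 2) / 2 - a / (a ^ 2 + y ^ 2)| ≤
      2 / (a ^ 2 + y ^ 2) := by
  have hp : 0 < a ^ 2 + y ^ 2 := by positivity
  have hq : 0 < (a + 1) ^ 2 + y ^ 2 := by positivity
  have hlog : Real.log ((a + 1) ^ 2 + y ^ 2) / 2 - Real.log (a ^ 2 + y ^ 2) / 2 =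
      Real.log (((a + 1) ^ 2 + y ^ 2) / (a ^ 2 + y ^ 2)) / 2 := by
    rw [Real.log_div hq.ne' hp.ne']; ring
  have hup := Real.log_le_sub_one_of_pos (div_pos hq hp)
  have hlo := Real.one_sub_inv_le_log_of_pos (div_pos hq hp)
  rw [hlog, abs_le]
  have e1 : ((a + 1) ^ 2 + y ^ 2) / (a ^ 2 + y ^ 2) - 1 = (2 * a + 1) / (a ^ 2 + y ^ 2) := by
    field_simp; ring
  have e2 : 1 - (((a + 1) ^ 2 + y ^ 2) / (a ^ 2 + y ^ 2))⁻¹ =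
      (2 * a + 1) / ((a + 1) ^ 2 + y ^ 2) := by
    field_simp; ring
  rw [e1] at hup
  rw [e2] at hlo
  constructor
  · have : (2 * a - 4) / (a ^ 2 + y ^ 2) ≤ (2 * a + 1) / ((a + 1) ^ 2 + y ^ 2) := by
      rw [div_le_div_iff₀ hp hq]
      nlinarith
    have e3 : (2 * a - 4) / (a ^ 2 + y ^ 2) = 2 * (a / (a ^ 2 + y ^ 2)) - 2 * (2 / (a ^ 2 + y ^ 2)) := by
      ring
    linarith
  · have e4 : (2 * a + 1) / (a ^ 2 + y ^ 2) = 2 * (a / (a ^ 2 + y ^ 2)) + 1 / (a ^ 2 + y ^ 2) := by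
      ring
    have e5 : 2 / (a ^ 2 + y ^ 2) = 2 * (1 / (a ^ 2 + y ^ 2)) := by ring
    have : 0 < 1 / (a ^ 2 + y ^ 2) := by positivity
    linarith

lemma summable_two_div_sq_add_one : Summable fun j : ℕ ↦ (2 : ℝ) / ((j : ℝ) ^ 2 + 1) := by
  refine Summable.of_nonneg_of_le (fun j ↦ by positivity) (fun j ↦ ?_)
    (((summable_nat_add_iff 1).2 (Real.summable_one_div_nat_pow.2 one_lt_two)).mul_left 4)
  push_cast
  rw [mul_one_div, div_le_div_iff₀ (by positivity) (by positivity)]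
  nlinarith [sq_nonneg ((j : ℝ) - 1)]

lemma abs_log_sub_sum_sub_log_le {x y : ℝ} (hx : 0 ≤ x) (hx1 : x ≤ 1) (hy : 1 ≤ y) {n : ℕ}
    (hn : y ≤ n) (hn2 : 2 ≤ n) :
    |Real.log n - ∑ j ∈ Finset.range (n + 1), (x + j) / ((x + j) ^ 2 + y ^ 2) - Real.log y| ≤
      (∑' j : ℕ, (2 : ℝ) / ((j : ℝ) ^ 2 + 1)) + 3 := by
  have hn0 : (2 : ℝ) ≤ n := by exact_mod_cast hn2
  let F : ℕ → ℝ := fun j ↦ Real.log ((x + j) ^ 2 + y ^ 2) / 2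
  have h1 : |∑ j ∈ Finset.range (n + 1), (F (j + 1) - F j) -
      ∑ j ∈ Finset.range (n + 1), (x + j) / ((x + j) ^ 2 + y ^ 2)| ≤
      ∑' j : ℕ, (2 : ℝ) / ((j : ℝ) ^ 2 + 1) := by
    rw [← Finset.sum_sub_distrib]
    refine (Finset.abs_sum_le_sum_abs _ _).trans (le_trans ?_
      (summable_two_div_sq_add_one.sum_le_tsum (Finset.range (n + 1)) fun _ _ ↦ by positivity))
    refine Finset.sum_le_sum fun j _ ↦ ?_
    have := abs_half_log_sub_sub_div_le (a := x + j) (by positivity) hy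
    simp only [F]
    push_cast
    rw [← add_assoc]
    refine this.trans ?_
    gcongr
    · linarith
    · nlinarith
  rw [Finset.sum_range_sub] at h1
  have h2 : |F 0 - Real.log y| ≤ 1 := by
    have e : F 0 - Real.log y = Real.log ((x ^ 2 + y ^ 2) / y ^ 2) / 2 := by
      simp only [F]
      rw [Real.log_div (by positivity) (by positivity), Real.log_pow]
      push_cast; simp; ring
    rw [e, abs_of_nonneg]
    · have := Real.log_le_sub_one_of_pos (x := (x ^ 2 + y ^ 2) / y ^ 2) (by positivity)
      have h3 : (x ^ 2 + y ^ 2) / y ^ 2 ≤ 2 := by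
        rw [div_le_iff₀ (by positivity)]; nlinarith
      linarith
    · have : 1 ≤ (x ^ 2 + y ^ 2) / y ^ 2 := by
        rw [le_div_iff₀ (by positivity)]; nlinarith
      have := Real.log_nonneg this
      positivity
  have h3 : |F (n + 1) - Real.log n| ≤ 2 := by
    have hn' : (0 : ℝ) < n := by linarith
    have e : F (n + 1) - Real.log n =
        Real.log (((x + (n + 1 : ℕ)) ^ 2 + y ^ 2) / (n : ℝ) ^ 2) / 2 := by
      simp only [F]
      rw [Real.log_div (by positivity) (by positivity), Real.log_pow]
      push_cast; ring
    rw [e, abs_of_nonneg]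
    · have := Real.log_le_sub_one_of_pos
        (x := ((x + (n + 1 : ℕ)) ^ 2 + y ^ 2) / (n : ℝ) ^ 2) (by positivity)
      have h3 : ((x + (n + 1 : ℕ)) ^ 2 + y ^ 2) / (n : ℝ) ^ 2 ≤ 5 := by
        rw [div_le_iff₀ (by positivity)]; push_cast
        have : x + (n + 1) ≤ 2 * n := by linarith
        nlinarith
      linarith
    · have : 1 ≤ ((x + (n + 1 : ℕ)) ^ 2 + y ^ 2) / (n : ℝ) ^ 2 := by
        rw [le_div_iff₀ (by positivity)]; push_cast; nlinarith
      have := Real.log_nonneg this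
      positivity
  rw [abs_le] at h1 h2 h3 ⊢
  constructor <;> linarith [h1.1, h1.2, h2.1, h2.2, h3.1, h3.2]

lemma log_norm_GammaSeq {x y : ℝ} (hx : 0 < x) {n : ℕ} (hn : 0 < n) :
    Real.log ‖Complex.GammaSeq (x + y * Complex.I) n‖ = x * Real.log n + Real.log n.factorial -
      ∑ j ∈ Finset.range (n + 1), Real.log ((x + j) ^ 2 + y ^ 2) / 2 := by
  have hn' : (0 : ℝ) < n := by exact_mod_cast hn
  have hterm (j : ℕ) : ‖(x + y * Complex.I + j : ℂ)‖ = Real.sqrt ((x + j) ^ 2 + y ^ 2) := by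
    rw [← Complex.norm_add_mul_I]
    congr 1
    push_cast
    ring
  have hfac : (0 : ℝ) < n.factorial := by exact_mod_cast n.factorial_pos
  have hprod : 0 < ∏ j ∈ Finset.range (n + 1), Real.sqrt ((x + j) ^ 2 + y ^ 2) :=
    Finset.prod_pos fun j _ ↦ by positivity
  rw [Complex.GammaSeq, norm_div, norm_mul, norm_prod]
  simp_rw [hterm]
  rw [Complex.norm_natCast_cpow_of_pos hn, Complex.norm_natCast]
  have hre : (x + y * Complex.I : ℂ).re = x := by simp
  rw [hre, Real.log_div (by positivity) hprod.ne', Real.log_mul (by positivity) hfac.ne',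
    Real.log_rpow hn', Real.log_prod fun j _ ↦ (by positivity)]
  congr 1
  refine Finset.sum_congr rfl fun j _ ↦ Real.log_sqrt (by positivity)

lemma hasDerivAt_log_norm {f : ℝ → ℂ} {f' : ℂ} {x : ℝ} (hf : HasDerivAt f f' x) (h0 : f x ≠ 0) :
    HasDerivAt (fun t ↦ Real.log ‖f t‖) (f' / f x).re x := by
  have h1 := (hf.norm_sq.log (by positivity)).div_const 2
  refine (h1.congr_deriv ?_).congr_of_eventuallyEq (.of_forall fun t ↦ ?_)
  · rw [Complex.inner, ← Complex.normSq_eq_norm_sq, div_eq_mul_inv f', Complex.inv_def]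
    have : Complex.normSq (f x) ≠ 0 := by simpa using h0
    simp only [Complex.mul_re, Complex.conj_re, Complex.conj_im, Complex.ofReal_re,
      Complex.ofReal_im, Complex.mul_im]
    field_simp
    ring
  · simp only [Real.log_pow]
    push_cast
    ring

theorem exists_abs_re_digamma_sub_log_le :
    ∃ C : ℝ, 0 < C ∧ ∀ x y : ℝ, 0 < x → x < 1 → 1 ≤ y →
      |(Complex.digamma (x + y * Complex.I)).re - Real.log y| ≤ C := by
  set C := (∑' j : ℕ, (2 : ℝ) / ((j : ℝ) ^ 2 + 1)) + 3 with hC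
  have hC0 : 0 < C := by
    have : 0 ≤ ∑' j : ℕ, (2 : ℝ) / ((j : ℝ) ^ 2 + 1) := tsum_nonneg fun j ↦ by positivity
    linarith
  refine ⟨C, hC0, fun x y hx hx1 hy ↦ ?_⟩
  have hre (t : ℝ) : (t + y * Complex.I : ℂ).re = t := by simp
  have hG (t : ℝ) (ht : 0 < t) : Complex.Gamma (t + y * Complex.I) ≠ 0 :=
    Complex.Gamma_ne_zero_of_re_pos (by rw [hre]; exact ht)
  have hlip (n : ℕ) (hn : y ≤ n) (hn2 : 2 ≤ n) (t : ℝ) (ht : t ∈ Set.Ioo (0 : ℝ) 1) :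
      ‖(Real.log ‖Complex.GammaSeq (t + y * Complex.I) n‖ - t * Real.log y) -
        (Real.log ‖Complex.GammaSeq (x + y * Complex.I) n‖ - x * Real.log y)‖ ≤
        C * ‖t - x‖ := by
    rw [log_norm_GammaSeq ht.1 (by omega), log_norm_GammaSeq hx (by omega)]
    refine Convex.norm_image_sub_le_of_norm_hasDerivWithin_le (s := Set.Ioo (0 : ℝ) 1)
      (f := fun t ↦ t * Real.log n + Real.log n.factorial -
      ∑ j ∈ Finset.range (n + 1), Real.log ((t + j) ^ 2 + y ^ 2) / 2 - t * Real.log y)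
      (f' := fun t ↦ Real.log n -
        ∑ j ∈ Finset.range (n + 1), (t + j) / ((t + j) ^ 2 + y ^ 2) - Real.log y)
      (fun u hu ↦ ?_) (fun u hu ↦ ?_) (convex_Ioo 0 1) ⟨hx, hx1⟩ ht
    · have hj (j : ℕ) : HasDerivAt (fun t : ℝ ↦ Real.log ((t + j) ^ 2 + y ^ 2) / 2)
          ((u + j) / ((u + j) ^ 2 + y ^ 2)) u := by
        have h1 : HasDerivAt (fun t : ℝ ↦ (t + j) ^ 2 + y ^ 2) (2 * (u + j)) u := by
          simpa using (((hasDerivAt_id u).add_const (j : ℝ)).pow 2).add_const (y ^ 2)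
        refine ((h1.log (by positivity)).div_const 2).congr_deriv ?_
        field_simp
      refine HasDerivAt.hasDerivWithinAt ?_
      have h2 := (((hasDerivAt_mul_const (Real.log n) (x := u)).add_const
        (Real.log n.factorial)).sub (HasDerivAt.fun_sum (u := Finset.range (n + 1))
          fun j _ ↦ hj j)).sub (hasDerivAt_mul_const (Real.log y) (x := u))
      exact h2
    · exact abs_log_sub_sum_sub_log_le hu.1.le hu.2.le hy hn hn2
  have hlim (t : ℝ) (ht : 0 < t) :
      Tendsto (fun n ↦ Real.log ‖Complex.GammaSeq (t + y * Complex.I) n‖) atTop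
        (𝓝 (Real.log ‖Complex.Gamma (t + y * Complex.I)‖)) :=
    ((Complex.GammaSeq_tendsto_Gamma _).norm).log (norm_ne_zero_iff.2 (hG t ht))
  have hlip' (t : ℝ) (ht : t ∈ Set.Ioo (0 : ℝ) 1) :
      ‖(Real.log ‖Complex.Gamma (t + y * Complex.I)‖ - t * Real.log y) -
        (Real.log ‖Complex.Gamma (x + y * Complex.I)‖ - x * Real.log y)‖ ≤ C * ‖t - x‖ := by
    refine le_of_tendsto ((((hlim t ht.1).sub_const _).sub ((hlim x hx).sub_const _)).norm) ?_
    obtain ⟨n₀, hn₀⟩ := exists_nat_ge y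
    filter_upwards [eventually_ge_atTop n₀, eventually_ge_atTop 2] with n hn hn2
    exact hlip n (hn₀.trans (by exact_mod_cast hn)) hn2 t ht
  have hder : HasDerivAt (fun t : ℝ ↦ Complex.Gamma (t + y * Complex.I))
      (deriv Complex.Gamma (x + y * Complex.I)) x := by
    have h1 : DifferentiableAt ℂ Complex.Gamma (x + y * Complex.I) := by
      refine Complex.differentiableAt_Gamma _ fun m h ↦ ?_
      have := congrArg Complex.re h
      simp at this
      have hm : (0 : ℝ) ≤ m := m.cast_nonneg
      linarith
    have h2 : HasDerivAt (fun z : ℂ ↦ Complex.Gamma (z + y * Complex.I))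
        (deriv Complex.Gamma (x + y * Complex.I)) (x : ℂ) :=
      HasDerivAt.comp_add_const (x : ℂ) (y * Complex.I) h1.hasDerivAt
    exact h2.comp_ofReal
  have hd := (hasDerivAt_log_norm hder (hG x hx)).sub (hasDerivAt_mul_const (Real.log y) (x := x))
  exact HasDerivAt.le_of_lip' hd hC0.le
    (by filter_upwards [Ioo_mem_nhds hx hx1] with t ht using hlip' t ht)

end Digamma

section CriticalLine

lemma completedRiemannZeta_conj (s : ℂ) (hs : s ≠ 0) (hs' : Complex.Gammaℝ s ≠ 0) :
    completedRiemannZeta ((starRingEnd ℂ) s) = (starRingEnd ℂ) (completedRiemannZeta s) := by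
  have hG : Complex.Gammaℝ ((starRingEnd ℂ) s) = (starRingEnd ℂ) (Complex.Gammaℝ s) := by
    rw [Complex.Gammaℝ_def, Complex.Gammaℝ_def, map_mul, ← Complex.Gamma_conj]
    congr 1
    · have := Complex.cpow_conj (Real.pi : ℂ) (-s / 2) (by
        rw [Complex.arg_ofReal_of_nonneg Real.pi_pos.le]; exact Real.pi_pos.ne)
      rw [Complex.conj_ofReal] at this
      rw [← this, map_div₀, map_neg, Complex.conj_ofNat]
    · rw [map_div₀, Complex.conj_ofNat]
  have h1 := riemannZeta_def_of_ne_zero hs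
  have h2 := riemannZeta_def_of_ne_zero (s := (starRingEnd ℂ) s) (by simpa using hs)
  rw [riemannZeta_conj, h1, hG, map_div₀] at h2
  have : (starRingEnd ℂ) (Complex.Gammaℝ s) ≠ 0 := by simpa using hs'
  field_simp at h2
  exact h2.symm

lemma hasDerivAt_Gammaℝ {s : ℂ} (hs : 0 < s.re) :
    HasDerivAt Complex.Gammaℝ
      (Complex.Gammaℝ s * (-Complex.log Real.pi / 2 + Complex.digamma (s / 2) / 2)) s := by
  have hs2 : 0 < (s / 2).re := by
    have : (s / 2).re = s.re / 2 := by simp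
    linarith
  have hG0 : Complex.Gamma (s / 2) ≠ 0 := Complex.Gamma_ne_zero_of_re_pos hs2
  have hpi : (Real.pi : ℂ) ≠ 0 := by exact_mod_cast Real.pi_ne_zero
  have h1 : DifferentiableAt ℂ Complex.Gamma (s / 2) := by
    refine Complex.differentiableAt_Gamma _ fun m h ↦ ?_
    rw [h] at hs2
    have hm : (0 : ℝ) ≤ m := m.cast_nonneg
    simp at hs2
    linarith
  have h2 : HasDerivAt (fun z : ℂ ↦ Complex.Gamma (z / 2)) (deriv Complex.Gamma (s / 2) * (1 / 2))
      s := h1.hasDerivAt.comp s ((hasDerivAt_id s).div_const 2)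
  have h3 : HasDerivAt (fun z : ℂ ↦ (Real.pi : ℂ) ^ (-z / 2))
      ((Real.pi : ℂ) ^ (-s / 2) * Complex.log Real.pi * (-1 / 2)) s :=
    ((hasDerivAt_id s).neg.div_const 2).const_cpow (Or.inl hpi)
  refine ((h3.mul h2).congr_deriv ?_).congr_of_eventuallyEq
    (.of_forall fun z ↦ Complex.Gammaℝ_def z)
  rw [Complex.Gammaℝ_def, Complex.digamma, logDeriv_apply]
  field_simp

lemma re_logDeriv_riemannZeta_add {t : ℝ} (ht : t ≠ 0)
    (h0 : riemannZeta (1 / 2 + t * Complex.I) ≠ 0) :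
    (logDeriv riemannZeta (1 / 2 + t * Complex.I)).re =
      (Complex.log Real.pi / 2 - Complex.digamma ((1 / 2 + t * Complex.I) / 2) / 2).re := by
  let c : ℝ → ℂ := fun x ↦ x + t * Complex.I
  have hcim (x : ℝ) : (c x).im = t := by simp [c]
  have hcre (x : ℝ) : (c x).re = x := by simp [c]
  have hc0 (x : ℝ) : c x ≠ 0 := fun h ↦ ht (by rw [← hcim x, h]; rfl)
  have hc1 (x : ℝ) : c x ≠ 1 := fun h ↦ ht (by rw [← hcim x, h]; rfl)
  have hGc (x : ℝ) : Complex.Gammaℝ (c x) ≠ 0 := fun h ↦ by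
    rw [Complex.Gammaℝ_eq_zero_iff] at h
    obtain ⟨n, hn⟩ := h
    apply ht
    rw [← hcim x, hn]
    simp
  have hfΛ (x : ℝ) : riemannZeta (c x) * Complex.Gammaℝ (c x) = completedRiemannZeta (c x) := by
    rw [riemannZeta_def_of_ne_zero (hc0 x), div_mul_cancel₀ _ (hGc x)]
  have hsymm (x : ℝ) : ‖riemannZeta (c (1 - x)) * Complex.Gammaℝ (c (1 - x))‖ =
      ‖riemannZeta (c x) * Complex.Gammaℝ (c x)‖ := by
    rw [hfΛ, hfΛ, ← completedRiemannZeta_one_sub]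
    have : 1 - c (1 - x) = (starRingEnd ℂ) (c x) := by
      apply Complex.ext <;> simp [c]
    rw [this, completedRiemannZeta_conj _ (hc0 x) (hGc x), RCLike.norm_conj]
  have hhalf : c (1 / 2) = 1 / 2 + t * Complex.I := by simp [c]
  rw [← hhalf] at h0 ⊢
  have hcd : HasDerivAt (fun z : ℂ ↦ z + t * Complex.I) 1 (((1 / 2 : ℝ) : ℝ) : ℂ) :=
    (hasDerivAt_id _).add_const _
  have hz := (differentiableAt_riemannZeta (hc1 (1 / 2))).hasDerivAt
  have hGd := hasDerivAt_Gammaℝ (s := c (1 / 2)) (by rw [hcre]; norm_num)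
  have hd : HasDerivAt (fun x : ℝ ↦ riemannZeta (c x) * Complex.Gammaℝ (c x)) _ (1 / 2 : ℝ) :=
    (HasDerivAt.comp (h₂ := fun z ↦ riemannZeta z * Complex.Gammaℝ z) (((1 / 2 : ℝ) : ℝ) : ℂ)
      (hz.mul hGd) hcd).comp_ofReal
  have hk := hasDerivAt_log_norm hd (mul_ne_zero h0 (hGc _))
  have hk' := HasDerivAt.comp_const_sub (1 : ℝ) (1 / 2 : ℝ) (by
    rw [show (1 : ℝ) - 1 / 2 = 1 / 2 by norm_num]; exact hk)
  simp only [hsymm] at hk'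
  have hzero := hk.unique hk'
  have hre := self_eq_neg.1 hzero
  rw [mul_one] at hre
  have hform : (deriv riemannZeta (c (1 / 2)) * Complex.Gammaℝ (c (1 / 2)) +
      riemannZeta (c (1 / 2)) * (Complex.Gammaℝ (c (1 / 2)) *
        (-Complex.log Real.pi / 2 + Complex.digamma (c (1 / 2) / 2) / 2))) /
      (riemannZeta (c (1 / 2)) * Complex.Gammaℝ (c (1 / 2))) =
      logDeriv riemannZeta (c (1 / 2)) -
        (Complex.log Real.pi / 2 - Complex.digamma (c (1 / 2) / 2) / 2) := by
    have := hGc (1 / 2)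
    rw [logDeriv_apply]
    field_simp
    ring
  rw [hform, Complex.sub_re, sub_eq_zero] at hre
  exact hre

/-- On the critical line the real part of `ζ'/ζ` is `-½ log t + O(1)`. -/
theorem exists_abs_re_logDeriv_riemannZeta_le :
    ∃ C : ℝ, 0 < C ∧ ∀ t : ℝ, 2 ≤ t → riemannZeta (1 / 2 + t * Complex.I) ≠ 0 →
      |(logDeriv riemannZeta (1 / 2 + t * Complex.I)).re + Real.log t / 2| ≤ C := by
  obtain ⟨C, hC, h⟩ := exists_abs_re_digamma_sub_log_le
  refine ⟨C + 2, by linarith, fun t ht h0 ↦ ?_⟩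
  rw [re_logDeriv_riemannZeta_add (by linarith) h0]
  have h1 := h (1 / 4) (t / 2) (by norm_num) (by norm_num) (by linarith)
  have e : ((1 / 2 + t * Complex.I) / 2 : ℂ) =
      ((1 / 4 : ℝ) : ℂ) + ((t / 2 : ℝ) : ℂ) * Complex.I := by push_cast; ring
  rw [e, Complex.sub_re, ← Complex.ofReal_log Real.pi_pos.le]
  have e2 (z : ℂ) : (z / 2).re = z.re / 2 := by simp
  rw [e2, e2, Complex.ofReal_re]
  rw [Real.log_div (by linarith) (by norm_num)] at h1
  have l1 : Real.log Real.pi ≤ 3 := by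
    have := Real.log_le_sub_one_of_pos Real.pi_pos
    linarith [Real.pi_lt_four]
  have l2 : 0 ≤ Real.log Real.pi := Real.log_nonneg (by linarith [Real.pi_gt_three])
  have l3 : 0 ≤ Real.log 2 := Real.log_nonneg (by norm_num)
  have l4 := Real.log_le_sub_one_of_pos (zero_lt_two' ℝ)
  rw [abs_le] at h1 ⊢
  constructor <;> linarith [h1.1, h1.2]

end CriticalLine

section Kernel

/-- The entire kernel `((4/a)² + w²) (sinh (a w) / (a w))⁴ exp (8 a w²)`; it is real on the
imaginary axis, and nonpositive there outside `[-4i/a, 4i/a]`. -/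
noncomputable def gapKernel (a : ℝ) (w : ℂ) : ℂ :=
  ((4 / a) ^ 2 + w ^ 2) * dslope Complex.sinh 0 (a * w) ^ 4 * Complex.exp (8 * a * w ^ 2)

/-- The restriction of `gapKernel` to the imaginary axis. -/
noncomputable def gapKernelIm (a y : ℝ) : ℝ :=
  ((4 / a) ^ 2 - y ^ 2) * Real.sinc (a * y) ^ 4 * Real.exp (-(8 * a * y ^ 2))

lemma differentiable_gapKernel (a : ℝ) : Differentiable ℂ (gapKernel a) := by
  have h1 : Differentiable ℂ (dslope Complex.sinh 0) := by
    rw [← differentiableOn_univ]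
    exact (Complex.differentiableOn_dslope univ_mem).2 Complex.differentiable_sinh.differentiableOn
  have h2 : Differentiable ℂ fun w : ℂ ↦ dslope Complex.sinh 0 (a * w) :=
    h1.comp (differentiable_id.const_mul _)
  unfold gapKernel
  fun_prop

lemma continuous_gapKernelIm (a : ℝ) : Continuous (gapKernelIm a) := by
  have : Continuous fun y ↦ Real.sinc (a * y) := Real.continuous_sinc.comp (by fun_prop)
  unfold gapKernelIm
  fun_prop

lemma gapKernel_mul_I (a y : ℝ) : gapKernel a (y * Complex.I) = gapKernelIm a y := by
  have h1 : dslope Complex.sinh 0 (a * (y * Complex.I)) = Real.sinc (a * y) := by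
    by_cases h : a * y = 0
    · have h' : (a : ℂ) * (y * Complex.I) = 0 := by
        rw [← mul_assoc, ← Complex.ofReal_mul, h]; simp
      rw [h', h, dslope_same]
      simp
    · have h' : (a : ℂ) * (y * Complex.I) ≠ 0 := by
        rw [← mul_assoc, ← Complex.ofReal_mul]
        exact mul_ne_zero (by exact_mod_cast h) Complex.I_ne_zero
      rw [dslope_of_ne _ h', slope_def_field, Real.sinc_of_ne_zero h, ← mul_assoc,
        Complex.sinh_mul_I]
      have : (a : ℂ) * y ≠ 0 := by exact_mod_cast h
      simp only [Complex.sinh_zero, sub_zero]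
      push_cast
      rw [mul_div_mul_right _ _ Complex.I_ne_zero]
  rw [gapKernel, h1, gapKernelIm]
  push_cast
  have h2 : ((y : ℂ) * Complex.I) ^ 2 = -(y : ℂ) ^ 2 := by rw [mul_pow, Complex.I_sq]; ring
  rw [h2]
  ring_nf

lemma gapKernelIm_nonpos {a y : ℝ} (ha : 0 < a) (hy : 4 / a ≤ |y|) : gapKernelIm a y ≤ 0 := by
  have h1 : (4 / a) ^ 2 ≤ y ^ 2 := by
    rw [← sq_abs y]
    gcongr
  have h2 : 0 ≤ Real.sinc (a * y) ^ 4 := by positivity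
  exact mul_nonpos_of_nonpos_of_nonneg
    (mul_nonpos_of_nonpos_of_nonneg (by linarith) h2) (Real.exp_pos _).le

lemma norm_dslope_sinh_le {z : ℂ} (hz : 1 ≤ ‖z‖) (hre : 0 ≤ z.re) :
    ‖dslope Complex.sinh 0 z‖ ≤ Real.exp z.re := by
  have h0 : z ≠ 0 := norm_pos_iff.1 (by linarith)
  rw [dslope_of_ne _ h0, slope_def_field]
  simp only [Complex.sinh_zero, sub_zero]
  rw [norm_div]
  refine (div_le_self (norm_nonneg _) hz).trans ?_
  rw [Complex.sinh, norm_div]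
  have h1 : ‖Complex.exp z - Complex.exp (-z)‖ ≤ Real.exp z.re + Real.exp z.re := by
    refine (norm_sub_le _ _).trans ?_
    rw [Complex.norm_exp, Complex.norm_exp, Complex.neg_re]
    gcongr
    linarith
  rw [Complex.norm_ofNat]
  linarith

lemma norm_gapKernel_le {a : ℝ} (ha : 4 ≤ a) {w : ℂ} (h0 : 0 ≤ w.re) (h1 : w.re ≤ 1)
    (hw : 1 ≤ ‖w‖) : ‖gapKernel a w‖ ≤ 2 * Real.exp (12 * a - 4 * a * w.im ^ 2) := by
  have ha0 : 0 < a := by linarith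
  have hzre : ((a : ℂ) * w).re = a * w.re := by simp
  have hS : ‖dslope Complex.sinh 0 (a * w)‖ ≤ Real.exp a := by
    refine (norm_dslope_sinh_le ?_ ?_).trans ?_
    · rw [norm_mul, Complex.norm_real, Real.norm_of_nonneg ha0.le]
      nlinarith
    · rw [hzre]; positivity
    · rw [hzre]; gcongr; nlinarith
  have hP : ‖((4 / a : ℂ) ^ 2 + w ^ 2)‖ ≤ 2 * Real.exp (w.im ^ 2 / 2) := by
    have e1 : ‖(4 / a : ℂ) ^ 2‖ ≤ 1 := by
      rw [norm_pow, norm_div, Complex.norm_real, Complex.norm_ofNat, Real.norm_of_nonneg ha0.le]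
      exact pow_le_one₀ (by positivity) ((div_le_one ha0).2 ha)
    have e2 : ‖w ^ 2‖ ≤ 1 + w.im ^ 2 := by
      rw [norm_pow, ← Complex.normSq_eq_norm_sq, Complex.normSq_apply]
      nlinarith
    have := Real.add_one_le_exp (w.im ^ 2 / 2)
    linarith [norm_add_le ((4 / a : ℂ) ^ 2) (w ^ 2)]
  have hE : ‖Complex.exp (8 * a * w ^ 2)‖ ≤ Real.exp (8 * a - 8 * a * w.im ^ 2) := by
    rw [Complex.norm_exp]
    have : (8 * (a : ℂ) * w ^ 2).re = 8 * a * (w.re ^ 2 - w.im ^ 2) := by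
      have e : 8 * (a : ℂ) * w ^ 2 = ((8 * a : ℝ) : ℂ) * (w * w) := by push_cast; ring
      rw [e, Complex.re_ofReal_mul, Complex.mul_re]
      ring
    rw [this]
    gcongr
    have : w.re ^ 2 ≤ 1 := by nlinarith
    nlinarith
  rw [gapKernel, norm_mul, norm_mul, norm_pow]
  calc _ ≤ 2 * Real.exp (w.im ^ 2 / 2) * Real.exp a ^ 4 * Real.exp (8 * a - 8 * a * w.im ^ 2) := by
        gcongr
    _ = 2 * Real.exp (w.im ^ 2 / 2 + 4 * a + (8 * a - 8 * a * w.im ^ 2)) := by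
        rw [Real.exp_add, Real.exp_add, ← Real.exp_nat_mul]
        push_cast
        ring
    _ ≤ _ := by
        gcongr
        nlinarith [sq_nonneg w.im]

lemma abs_sinc_le_inv {x : ℝ} (hx : x ≠ 0) : |Real.sinc x| ≤ |x|⁻¹ := by
  rw [Real.sinc_of_ne_zero hx, abs_div, ← one_div]
  gcongr
  exact Real.abs_sin_le_one x

lemma sinc_pow_four_le (u : ℝ) : (16 + u ^ 2) * Real.sinc u ^ 4 ≤ 34 * (1 + u ^ 2)⁻¹ ∧
    u ^ 2 * Real.sinc u ^ 4 ≤ 2 * (1 + u ^ 2)⁻¹ := by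
  have hs : Real.sinc u ^ 4 = |Real.sinc u| ^ 4 := (Even.pow_abs (by decide) _).symm
  rw [hs, ← div_eq_mul_inv, ← div_eq_mul_inv]
  have hp : 0 < 1 + u ^ 2 := by positivity
  rw [le_div_iff₀ hp, le_div_iff₀ hp]
  rcases le_total (|u|) 1 with h | h
  · have h1 : u ^ 2 ≤ 1 := by rw [← sq_abs]; exact pow_le_one₀ (abs_nonneg u) h
    have h2 : |Real.sinc u| ^ 4 ≤ 1 := pow_le_one₀ (abs_nonneg _) (Real.abs_sinc_le_one u)
    have h3 : 0 ≤ |Real.sinc u| ^ 4 := by positivity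
    have h4 : 0 ≤ u ^ 2 := sq_nonneg u
    constructor
    · have : (16 + u ^ 2) * |Real.sinc u| ^ 4 ≤ 17 := by nlinarith
      nlinarith
    · have : u ^ 2 * |Real.sinc u| ^ 4 ≤ 1 := by nlinarith
      nlinarith
  · have h1 : 1 ≤ u ^ 2 := by rw [← sq_abs]; exact one_le_pow₀ h
    have hu : u ≠ 0 := fun h ↦ by rw [h] at h1; norm_num at h1
    have h2 : |Real.sinc u| ^ 4 * (u ^ 2) ^ 2 ≤ 1 := by
      have : |Real.sinc u| * |u| ≤ 1 := by
        rw [← le_div_iff₀ (abs_pos.2 hu), one_div]; exact abs_sinc_le_inv hu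
      have h3 := pow_le_one₀ (n := 4) (by positivity) this
      rw [mul_pow, Even.pow_abs (by decide) u] at h3
      rw [← pow_mul]
      exact h3
    have h3 : 0 ≤ |Real.sinc u| ^ 4 := by positivity
    generalize |Real.sinc u| ^ 4 = s at *
    generalize u ^ 2 = q at *
    have hqs : s * q ≤ s * q ^ 2 := mul_le_mul_of_nonneg_left (by nlinarith) h3
    have hqs' : s ≤ s * q := le_mul_of_one_le_right h3 h1
    constructor <;> nlinarith

lemma three_fourths_le_sinc {u : ℝ} (hu : |u| ≤ 1) : 3 / 4 ≤ Real.sinc u := by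
  wlog h : 0 ≤ u generalizing u
  · rw [← Real.sinc_neg]
    exact this (by rwa [abs_neg]) (by linarith)
  rw [abs_of_nonneg h] at hu
  rcases h.eq_or_lt with rfl | h
  · rw [Real.sinc_zero]; norm_num
  · rw [Real.sinc_of_ne_zero h.ne', le_div_iff₀ h]
    have := Real.sin_gt_sub_cube h
    have h2 : u ^ 3 ≤ u := by nlinarith [sq_nonneg u]
    linarith

lemma integral_inv_one_add_mul_sq_le {a : ℝ} (ha : 0 < a) (b c : ℝ) :
    ∫ y in b..c, (1 + (a * y) ^ 2)⁻¹ ≤ Real.pi / a := by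
  rw [intervalIntegral.integral_comp_mul_left (fun u ↦ (1 + u ^ 2)⁻¹) ha.ne',
    integral_inv_one_add_sq, smul_eq_mul, inv_mul_eq_div]
  gcongr
  linarith [Real.arctan_lt_pi_div_two (a * c), Real.neg_pi_div_two_lt_arctan (a * b)]

lemma continuous_inv_one_add_mul_sq (a : ℝ) : Continuous fun y : ℝ ↦ (1 + (a * y) ^ 2)⁻¹ :=
  Continuous.inv₀ (by fun_prop) fun y ↦ by positivity

lemma integral_abs_gapKernelIm_le {a : ℝ} (ha : 0 < a) :
    ∫ y in (-2 : ℝ)..2, |gapKernelIm a y| ≤ 34 * Real.pi / a ^ 3 := by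
  have hpt (y : ℝ) : |gapKernelIm a y| ≤ 34 / a ^ 2 * (1 + (a * y) ^ 2)⁻¹ := by
    have h1 := (sinc_pow_four_le (a * y)).1
    have h2 : |(4 / a) ^ 2 - y ^ 2| ≤ (16 + (a * y) ^ 2) / a ^ 2 := by
      have e : (16 + (a * y) ^ 2) / a ^ 2 = (4 / a) ^ 2 + y ^ 2 := by field_simp; ring
      rw [e, abs_le]
      constructor <;> linarith [sq_nonneg (4 / a), sq_nonneg y]
    have h3 : Real.exp (-(8 * a * y ^ 2)) ≤ 1 := Real.exp_le_one_iff.2 (by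
      have : 0 ≤ 8 * a * y ^ 2 := by positivity
      linarith)
    have h4 : 0 ≤ Real.sinc (a * y) ^ 4 := by positivity
    rw [gapKernelIm, abs_mul, abs_mul, abs_of_nonneg h4, abs_of_pos (Real.exp_pos _)]
    calc _ ≤ (16 + (a * y) ^ 2) / a ^ 2 * Real.sinc (a * y) ^ 4 * 1 := by gcongr
      _ = ((16 + (a * y) ^ 2) * Real.sinc (a * y) ^ 4) / a ^ 2 := by ring
      _ ≤ (34 * (1 + (a * y) ^ 2)⁻¹) / a ^ 2 := by gcongr
      _ = _ := by ring
  calc _ ≤ ∫ y in (-2 : ℝ)..2, 34 / a ^ 2 * (1 + (a * y) ^ 2)⁻¹ :=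
        intervalIntegral.integral_mono_on (by norm_num)
          ((continuous_gapKernelIm a).abs.intervalIntegrable _ _)
          ((continuous_inv_one_add_mul_sq a).const_mul _ |>.intervalIntegrable _ _)
          fun y _ ↦ hpt y
    _ = 34 / a ^ 2 * ∫ y in (-2 : ℝ)..2, (1 + (a * y) ^ 2)⁻¹ :=
        intervalIntegral.integral_const_mul _ _
    _ ≤ 34 / a ^ 2 * (Real.pi / a) := by
        gcongr
        exact integral_inv_one_add_mul_sq_le ha _ _
    _ = _ := by field_simp

lemma le_integral_gapKernelIm {a : ℝ} (ha : 80 ≤ a) :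
    2 / a ^ 3 ≤ ∫ y in (-2 : ℝ)..2, gapKernelIm a y := by
  have ha0 : 0 < a := by linarith
  have hsc : Continuous fun y ↦ Real.sinc (a * y) := Real.continuous_sinc.comp (by fun_prop)
  let F : ℝ → ℝ := fun y ↦ (4 / a) ^ 2 * Real.sinc (a * y) ^ 4 * Real.exp (-(8 * a * y ^ 2))
  let G : ℝ → ℝ := fun y ↦ 2 / a ^ 2 * (1 + (a * y) ^ 2)⁻¹
  have hF : Continuous F := by simp only [F]; fun_prop
  have hG : Continuous G := (continuous_inv_one_add_mul_sq a).const_mul _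
  have hF0 (y : ℝ) : 0 ≤ F y := by simp only [F]; positivity
  have hpt (y : ℝ) : F y - G y ≤ gapKernelIm a y := by
    have h1 := (sinc_pow_four_le (a * y)).2
    have h3 : Real.exp (-(8 * a * y ^ 2)) ≤ 1 := Real.exp_le_one_iff.2 (by
      have : 0 ≤ 8 * a * y ^ 2 := by positivity
      linarith)
    have h4 : 0 ≤ Real.sinc (a * y) ^ 4 := by positivity
    have h5 : y ^ 2 * Real.sinc (a * y) ^ 4 * Real.exp (-(8 * a * y ^ 2)) ≤ G y := by
      calc _ ≤ y ^ 2 * Real.sinc (a * y) ^ 4 * 1 := by gcongr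
        _ = ((a * y) ^ 2 * Real.sinc (a * y) ^ 4) / a ^ 2 := by field_simp
        _ ≤ (2 * (1 + (a * y) ^ 2)⁻¹) / a ^ 2 := by gcongr
        _ = _ := by simp only [G]; ring
    simp only [F, gapKernelIm, sub_mul] at h5 ⊢
    linarith
  have hFlow (y : ℝ) (hy : y ∈ Set.Icc (-(1 / a)) (1 / a)) : (9 / 2) / a ^ 2 ≤ F y := by
    have hay : |a * y| ≤ 1 := by
      rw [abs_mul, abs_of_pos ha0]
      have : |y| ≤ 1 / a := abs_le.2 hy
      calc a * |y| ≤ a * (1 / a) := by gcongr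
        _ = 1 := by field_simp
    have hs : (3 / 4 : ℝ) ^ 4 ≤ Real.sinc (a * y) ^ 4 := by
      gcongr
      exact three_fourths_le_sinc hay
    have he : (9 / 10 : ℝ) ≤ Real.exp (-(8 * a * y ^ 2)) := by
      have h1 := Real.add_one_le_exp (-(8 * a * y ^ 2))
      have h2 : (a * y) ^ 2 ≤ 1 := by rw [← sq_abs]; exact pow_le_one₀ (abs_nonneg _) hay
      have h3 : 8 * a * y ^ 2 ≤ 1 / 10 := by
        have e : 8 * a * y ^ 2 = 8 * (a * y) ^ 2 / a := by field_simp
        rw [e, div_le_iff₀ ha0]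
        linarith
      linarith
    calc (9 / 2) / a ^ 2 ≤ (4 / a) ^ 2 * (3 / 4 : ℝ) ^ 4 * (9 / 10) := by
          rw [div_pow, div_mul_eq_mul_div, div_mul_eq_mul_div]
          gcongr
          norm_num
      _ ≤ F y := by simp only [F]; gcongr
  have hFint : 9 / a ^ 3 ≤ ∫ y in (-2 : ℝ)..2, F y := by
    have h1a : 1 / a ≤ 2 := by rw [div_le_iff₀ ha0]; linarith
    have h1a' : 0 < 1 / a := by positivity
    calc 9 / a ^ 3 = ∫ _y in (-(1 / a))..(1 / a), (9 / 2) / a ^ 2 := by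
          rw [intervalIntegral.integral_const, smul_eq_mul]
          field_simp
          norm_num
      _ ≤ ∫ y in (-(1 / a))..(1 / a), F y :=
          intervalIntegral.integral_mono_on (by linarith) (by simp)
            (hF.intervalIntegrable _ _) hFlow
      _ ≤ _ := intervalIntegral.integral_mono_interval (by linarith) (by linarith) h1a
          (.of_forall fun y ↦ hF0 y) (hF.intervalIntegrable _ _)
  have hGint : ∫ y in (-2 : ℝ)..2, G y ≤ 7 / a ^ 3 := by
    simp only [G]
    rw [intervalIntegral.integral_const_mul]
    calc _ ≤ 2 / a ^ 2 * (Real.pi / a) := by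
          gcongr
          exact integral_inv_one_add_mul_sq_le ha0 _ _
      _ = 2 * Real.pi / a ^ 3 := by field_simp
      _ ≤ 7 / a ^ 3 := by
          gcongr
          linarith [Real.pi_lt_d2]
  calc 2 / a ^ 3 = 9 / a ^ 3 - 7 / a ^ 3 := by ring
    _ ≤ (∫ y in (-2 : ℝ)..2, F y) - ∫ y in (-2 : ℝ)..2, G y := by linarith
    _ = ∫ y in (-2 : ℝ)..2, (F y - G y) := (intervalIntegral.integral_sub
        (hF.intervalIntegrable _ _) (hG.intervalIntegrable _ _)).symm
    _ ≤ _ := intervalIntegral.integral_mono_on (by norm_num)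
        ((hF.sub hG).intervalIntegrable _ _)
        ((continuous_gapKernelIm a).intervalIntegrable _ _) fun y _ ↦ hpt y

end Kernel

section Contour

open MeasureTheory

lemma integral_one_add_eq {D : ℂ → ℂ} {Y : ℝ} (hY : 0 ≤ Y)
    (hD : DifferentiableOn ℂ D (Set.Icc 0 1 ×ℂ Set.Icc (-Y) Y)) :
    ∫ y in (-Y)..Y, D (1 + y * Complex.I) = (∫ y in (-Y)..Y, D (y * Complex.I)) + Complex.I *
      ((∫ x in (0 : ℝ)..1, D (x - Y * Complex.I)) - ∫ x in (0 : ℝ)..1, D (x + Y * Complex.I)) := by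
  have h := Complex.integral_boundary_rect_eq_zero_of_differentiableOn D ⟨0, -Y⟩ ⟨1, Y⟩ (by
    rwa [Set.uIcc_of_le zero_le_one, Set.uIcc_of_le (by simpa using hY)])
  simp only [Complex.ofReal_neg, neg_mul, ← sub_eq_add_neg, smul_eq_mul, Complex.ofReal_one,
    Complex.ofReal_zero, zero_add] at h
  linear_combination (-Complex.I) * h +
    ((∫ y in (-Y)..Y, D (1 + y * Complex.I)) - ∫ y in (-Y)..Y, D (y * Complex.I)) * Complex.I_sq

lemma re_intervalIntegral {f : ℝ → ℂ} {a b : ℝ} (hf : IntervalIntegrable f volume a b) :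
    (∫ x in a..b, f x).re = ∫ x in a..b, (f x).re :=
  (Complex.reCLM.intervalIntegral_comp_comm hf).symm

lemma im_intervalIntegral {f : ℝ → ℂ} {a b : ℝ} (hf : IntervalIntegrable f volume a b) :
    (∫ x in a..b, f x).im = ∫ x in a..b, (f x).im :=
  (Complex.imCLM.intervalIntegral_comp_comm hf).symm

lemma norm_integral_mul_sub_le {K e : ℂ → ℂ} (hK : Differentiable ℂ K) {ε M Y : ℝ} (hY : 0 ≤ Y)
    (hε : ∀ w : ℂ, 0 ≤ w.re → w.re ≤ 1 → Y ≤ |w.im| → ‖K w‖ ≤ ε)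
    (he : DifferentiableOn ℂ e (Set.Icc 0 1 ×ℂ Set.Icc (-Y) Y))
    (heM : ∀ w ∈ Set.Icc 0 1 ×ℂ Set.Icc (-Y) Y, ‖e w‖ ≤ M) :
    ‖(∫ y in (-Y)..Y, e (1 + y * Complex.I) * K (1 + y * Complex.I)) -
      ∫ y in (-Y)..Y, e (y * Complex.I) * K (y * Complex.I)‖ ≤ 2 * (M * ε) := by
  have h := integral_one_add_eq hY (he.mul hK.differentiableOn)
  simp only [Pi.mul_apply] at h
  rw [h, add_sub_cancel_left, norm_mul, Complex.norm_I, one_mul]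
  refine (norm_sub_le _ _).trans ?_
  have hb (σ : ℝ) (hσ : |σ| = Y) (x : ℝ) (hx : x ∈ Set.uIoc (0 : ℝ) 1) :
      ‖e (x + σ * Complex.I) * K (x + σ * Complex.I)‖ ≤ M * ε := by
    rw [Set.uIoc_of_le zero_le_one] at hx
    have hre : (x + σ * Complex.I : ℂ).re = x := by simp
    have him : (x + σ * Complex.I : ℂ).im = σ := by simp
    have hmem : (x + σ * Complex.I : ℂ) ∈ Set.Icc (0 : ℝ) 1 ×ℂ Set.Icc (-Y) Y := by
      rw [Complex.mem_reProdIm, hre, him]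
      exact ⟨⟨hx.1.le, hx.2⟩, abs_le.1 hσ.le⟩
    rw [norm_mul]
    exact mul_le_mul (heM _ hmem) (hε _ (by rw [hre]; exact hx.1.le) (by rw [hre]; exact hx.2)
      (by rw [him]; exact hσ.ge)) (norm_nonneg _) ((norm_nonneg _).trans (heM _ hmem))
  have h1 := intervalIntegral.norm_integral_le_of_norm_le_const (hb Y (abs_of_nonneg hY))
  have h2 := intervalIntegral.norm_integral_le_of_norm_le_const
    (hb (-Y) (by rw [abs_neg, abs_of_nonneg hY]))
  simp only [Complex.ofReal_neg, neg_mul, ← sub_eq_add_neg, sub_zero, abs_one, mul_one] at h1 h2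
  linarith

lemma abs_integral_le_of_abs_le {q : ℝ → ℝ} {a b ε : ℝ} (hq : ∀ y ∈ Set.Icc a b, |q y| ≤ ε)
    (hab : a ≤ b) : |∫ y in a..b, q y| ≤ ε * (b - a) := by
  have := intervalIntegral.norm_integral_le_of_norm_le_const (f := q) (a := a) (b := b) (C := ε)
    fun y hy ↦ by
      rw [Set.uIoc_of_le hab] at hy
      exact hq y ⟨hy.1.le, hy.2⟩
  rwa [abs_of_nonneg (sub_nonneg.2 hab)] at this

/-- The contribution of a pole at `v * I` on the imaginary axis, where the kernel is
nonpositive. -/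
theorem re_integral_div_le {K : ℂ → ℂ} (hK : Differentiable ℂ K) {h : ℝ → ℝ}
    (hKh : ∀ y : ℝ, K (y * Complex.I) = h y) {ε v : ℝ}
    (hε : ∀ w : ℂ, 0 ≤ w.re → w.re ≤ 1 → 2 ≤ |w.im| → ‖K w‖ ≤ ε) (hv : |v| ≤ 5 / 2)
    (hhv : h v ≤ 0) :
    (∫ y in (-2 : ℝ)..2, K (1 + y * Complex.I) / (1 + y * Complex.I - v * Complex.I)).re ≤
      6 * ε := by
  rw [abs_le] at hv
  let D : ℂ → ℂ := dslope K (v * Complex.I)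
  have hD : Differentiable ℂ D := by
    rw [← differentiableOn_univ]
    exact (Complex.differentiableOn_dslope univ_mem).2 hK.differentiableOn
  have hDw (w : ℂ) (hw : w ≠ v * Complex.I) : D w = K w / (w - v * Complex.I) -
      (h v : ℂ) * (1 / (w - v * Complex.I)) := by
    simp only [D]
    rw [dslope_of_ne _ hw, slope_def_field, hKh, sub_div, mul_one_div]
  have hinv (w : ℂ) : (1 / (w - v * Complex.I)).re = w.re / Complex.normSq (w - v * Complex.I) ∧
      (1 / (w - v * Complex.I)).im = -(w.im - v) / Complex.normSq (w - v * Complex.I) := by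
    rw [one_div, Complex.inv_re, Complex.inv_im]
    simp
  have hrect := congrArg Complex.re (integral_one_add_eq (D := D) (Y := 3) (by norm_num)
    hD.differentiableOn)
  have hDc : Continuous D := hD.continuous
  have hcont (f : ℝ → ℂ) (hf : Continuous f) (a b : ℝ) :
      IntervalIntegrable (fun x ↦ D (f x)) volume a b := (hDc.comp hf).intervalIntegrable _ _
  have c1 : Continuous fun y : ℝ ↦ (1 + y * Complex.I : ℂ) := by fun_prop
  have c2 : Continuous fun y : ℝ ↦ (y * Complex.I : ℂ) := by fun_prop
  have c3 : Continuous fun x : ℝ ↦ (x - (3 : ℝ) * Complex.I : ℂ) := by fun_prop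
  have c4 : Continuous fun x : ℝ ↦ (x + (3 : ℝ) * Complex.I : ℂ) := by fun_prop
  rw [Complex.add_re, Complex.I_mul_re, Complex.sub_im, re_intervalIntegral (hcont _ c1 _ _),
    re_intervalIntegral (hcont _ c2 _ _), im_intervalIntegral (hcont _ c3 _ _),
    im_intervalIntegral (hcont _ c4 _ _)] at hrect
  have hleft : ∫ y in (-3 : ℝ)..3, (D (y * Complex.I)).re = 0 := by
    rw [← intervalIntegral.integral_zero (a := (-3 : ℝ)) (b := 3) (μ := volume) (E := ℝ)]
    refine intervalIntegral.integral_congr_ae ?_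
    filter_upwards [(Set.countable_singleton v).ae_notMem volume] with y hy _
    have hyv : (y : ℂ) * Complex.I ≠ v * Complex.I := fun h ↦ hy (by
      simpa using mul_right_cancel₀ Complex.I_ne_zero h)
    rw [hDw _ hyv, hKh, ← mul_one_div, ← sub_mul, ← Complex.ofReal_sub, Complex.re_ofReal_mul,
      (hinv _).1]
    simp
  have hKq (w : ℂ) (h0 : 0 ≤ w.re) (h1 : w.re ≤ 1) (h2 : 2 ≤ |w.im|) {d : ℝ} (hd : 0 < d)
      (h3 : d ≤ ‖w - v * Complex.I‖) : ‖K w / (w - v * Complex.I)‖ ≤ ε / d := by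
    rw [norm_div]
    have := hε w h0 h1 h2
    gcongr
    exact (norm_nonneg _).trans this
  have hdist (x σ : ℝ) (hσ : |σ| = 3) :
      1 / 2 ≤ ‖(x + σ * Complex.I : ℂ) - v * Complex.I‖ := by
    have h1 := Complex.abs_im_le_norm ((x + σ * Complex.I : ℂ) - v * Complex.I)
    have h2 : ((x + σ * Complex.I : ℂ) - v * Complex.I).im = σ - v := by simp
    rw [h2] at h1
    refine le_trans ?_ h1
    rcases (abs_eq (by norm_num)).1 hσ with rfl | rfl
    · exact le_trans (by linarith [hv.2]) (le_abs_self _)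
    · exact le_trans (by linarith [hv.1]) (neg_le_abs _)
  have hne (x σ : ℝ) (hσ : |σ| = 3) : (x + σ * Complex.I : ℂ) ≠ v * Complex.I := fun h ↦ by
    have := hdist x σ hσ
    rw [h, sub_self, norm_zero] at this
    norm_num at this
  have him (x σ : ℝ) (hσ : |σ| = 3) (hx : x ∈ Set.Icc (0 : ℝ) 1) :
      |(K (x + σ * Complex.I) / (x + σ * Complex.I - v * Complex.I)).im| ≤ 2 * ε := by
    refine (Complex.abs_im_le_norm _).trans ((hKq _ ?_ ?_ ?_ one_half_pos
      (hdist x σ hσ)).trans_eq (by ring))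
    · simpa using hx.1
    · simpa using hx.2
    · simp [hσ]; norm_num
  have hbot : -(2 * ε) ≤ ∫ x in (0 : ℝ)..1, (D (x - (3 : ℝ) * Complex.I)).im := by
    have hpt (x : ℝ) (hx : x ∈ Set.Icc (0 : ℝ) 1) :
        -(2 * ε) ≤ (D (x - (3 : ℝ) * Complex.I)).im := by
      have e : (x - (3 : ℝ) * Complex.I : ℂ) = x + ((-3 : ℝ) : ℂ) * Complex.I := by
        push_cast; ring
      have h3 : |(-3 : ℝ)| = 3 := by norm_num
      rw [e, hDw _ (hne x _ h3), Complex.sub_im, Complex.im_ofReal_mul, (hinv _).2]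
      have h1 := (abs_le.1 (him x _ h3 hx)).1
      have h2 : 0 ≤ -((x + ((-3 : ℝ) : ℂ) * Complex.I).im - v) /
          Complex.normSq (x + ((-3 : ℝ) : ℂ) * Complex.I - v * Complex.I) := by
        refine div_nonneg ?_ (Complex.normSq_nonneg _)
        simp
        linarith [hv.1]
      nlinarith
    have := intervalIntegral.integral_mono_on (a := (0 : ℝ)) (b := 1) (μ := volume) zero_le_one
      (by simp : IntervalIntegrable (fun _ ↦ -(2 * ε)) volume 0 1)
      ((Complex.continuous_im.comp (hDc.comp c3)).intervalIntegrable _ _) hpt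
    simpa using this
  have htop : ∫ x in (0 : ℝ)..1, (D (x + (3 : ℝ) * Complex.I)).im ≤ 2 * ε := by
    have hpt (x : ℝ) (hx : x ∈ Set.Icc (0 : ℝ) 1) :
        (D (x + (3 : ℝ) * Complex.I)).im ≤ 2 * ε := by
      have h3 : |(3 : ℝ)| = 3 := by norm_num
      rw [hDw _ (hne x _ h3), Complex.sub_im, Complex.im_ofReal_mul, (hinv _).2]
      have h1 := (abs_le.1 (him x _ h3 hx)).2
      have h2 : -((x + ((3 : ℝ) : ℂ) * Complex.I).im - v) /
          Complex.normSq (x + ((3 : ℝ) : ℂ) * Complex.I - v * Complex.I) ≤ 0 := by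
        refine div_nonpos_of_nonpos_of_nonneg ?_ (Complex.normSq_nonneg _)
        simp
        linarith [hv.2]
      nlinarith
    have := intervalIntegral.integral_mono_on (a := (0 : ℝ)) (b := 1) (μ := volume) zero_le_one
      ((Complex.continuous_im.comp (hDc.comp c4)).intervalIntegrable _ _)
      (by simp : IntervalIntegrable (fun _ ↦ 2 * ε) volume 0 1) hpt
    simpa using this
  have hne1 (y : ℝ) : (1 + y * Complex.I : ℂ) - v * Complex.I ≠ 0 := fun h ↦ by
    have := congrArg Complex.re h
    simp at this
  have hqc : Continuous fun y : ℝ ↦ K (1 + y * Complex.I) / (1 + y * Complex.I - v * Complex.I) :=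
    (hK.continuous.comp c1).div (by fun_prop) hne1
  set q : ℝ → ℝ := fun y ↦ (K (1 + y * Complex.I) / (1 + y * Complex.I - v * Complex.I)).re with hq
  have hqc' : Continuous q := Complex.continuous_re.comp hqc
  have hq3 : ∫ y in (-3 : ℝ)..3, q y ≤ 4 * ε := by
    have hpt (y : ℝ) : q y ≤ (D (1 + y * Complex.I)).re := by
      rw [hDw _ (sub_ne_zero.1 (hne1 y)), Complex.sub_re, Complex.re_ofReal_mul, (hinv _).1]
      have h2 : 0 ≤ (1 + y * Complex.I : ℂ).re /
          Complex.normSq (1 + y * Complex.I - v * Complex.I) :=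
        div_nonneg (by simp) (Complex.normSq_nonneg _)
      simp only [hq]
      nlinarith
    have := intervalIntegral.integral_mono_on (a := (-3 : ℝ)) (b := 3) (μ := volume) (by norm_num)
      (hqc'.intervalIntegrable _ _)
      ((Complex.continuous_re.comp (hDc.comp c1)).intervalIntegrable _ _) fun y _ ↦ hpt y
    simp only [Function.comp] at this
    linarith
  have htail (y : ℝ) (hy : 2 ≤ |y|) : |q y| ≤ ε := by
    refine (Complex.abs_re_le_norm _).trans ((hKq _ ?_ ?_ ?_ one_pos ?_).trans_eq (div_one ε))
    · simp
    · simp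
    · simpa using hy
    · refine le_trans ?_ (Complex.abs_re_le_norm _)
      simp
  have ht1 := (abs_le.1 (abs_integral_le_of_abs_le (a := (-3 : ℝ)) (b := -2)
    (fun y hy ↦ htail y (by rw [abs_of_nonpos (by linarith [hy.2])]; linarith [hy.2]))
    (by norm_num))).1
  have ht2 := (abs_le.1 (abs_integral_le_of_abs_le (a := (2 : ℝ)) (b := 3)
    (fun y hy ↦ htail y (by rw [abs_of_nonneg (by linarith [hy.1])]; linarith [hy.1]))
    (by norm_num))).1
  have hs1 := intervalIntegral.integral_add_adjacent_intervals
    (hqc'.intervalIntegrable (μ := volume) (-3) (-2)) (hqc'.intervalIntegrable (-2) 2)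
  have hs2 := intervalIntegral.integral_add_adjacent_intervals
    (hqc'.intervalIntegrable (μ := volume) (-3) 2) (hqc'.intervalIntegrable 2 3)
  rw [re_intervalIntegral (hqc.intervalIntegrable _ _)]
  change ∫ y in (-2 : ℝ)..2, q y ≤ 6 * ε
  linarith

end Contour

section Dirichlet

lemma norm_LSeries_le {f : ℕ → ℂ} {s s' : ℂ} (hf : LSeriesSummable f s) (h : s.re ≤ s'.re) :
    ‖LSeries f s'‖ ≤ ∑' n, ‖LSeries.term f s n‖ := by
  have h' := hf.of_re_le_re h
  refine (norm_tsum_le_tsum_norm h'.norm).trans ?_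
  exact h'.norm.tsum_le_tsum (fun n ↦ LSeries.norm_term_le_of_re_le_re f h n) hf.norm

lemma exists_norm_logDeriv_riemannZeta_le :
    ∃ C : ℝ, 0 < C ∧ ∀ s : ℂ, 3 / 2 ≤ s.re → ‖logDeriv riemannZeta s‖ ≤ C := by
  have h32 : (1 : ℝ) < (3 / 2 : ℂ).re := by norm_num
  refine ⟨_ + 1, add_pos_of_nonneg_of_pos (tsum_nonneg fun n ↦ norm_nonneg _) one_pos,
    fun s hs ↦ ((?_ : _ ≤ _).trans
      (norm_LSeries_le (ArithmeticFunction.LSeriesSummable_vonMangoldt h32) (s' := s) ?_)).trans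
      (le_add_of_nonneg_right zero_le_one)⟩
  · rw [ArithmeticFunction.LSeries_vonMangoldt_eq_deriv_riemannZeta_div (by linarith),
      neg_div, norm_neg, logDeriv_apply]
  · norm_num; exact hs

lemma exists_le_norm_riemannZeta :
    ∃ c : ℝ, 0 < c ∧ ∀ s : ℂ, 2 ≤ s.re → c ≤ ‖riemannZeta s‖ := by
  have h2 : (1 : ℝ) < (2 : ℂ).re := by norm_num
  have hμ := ArithmeticFunction.LSeriesSummable_moebius_iff.2 h2
  set B := ∑' n, ‖LSeries.term (fun n ↦ ((ArithmeticFunction.moebius n : ℤ) : ℂ)) 2 n‖ with hB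
  have hB0 : 0 ≤ B := tsum_nonneg fun n ↦ norm_nonneg _
  refine ⟨1 / (B + 1), by positivity, fun s hs ↦ ?_⟩
  have hs1 : 1 < s.re := by linarith
  have h := ArithmeticFunction.LSeries_zeta_mul_Lseries_moebius hs1
  rw [ArithmeticFunction.LSeries_zeta_eq_riemannZeta hs1] at h
  have hn := congrArg norm h
  rw [norm_mul, norm_one] at hn
  have hle := norm_LSeries_le hμ (s' := s) (by norm_num; exact hs)
  rw [div_le_iff₀ (by positivity), ← hn]
  gcongr
  exact hle.trans (by linarith)

end Dirichlet

section PartialFractions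

open Metric

lemma logDeriv_eq_sum_add {f g : ℂ → ℂ} {N : ℕ} {ρ : Fin N → ℂ} {R : ℝ}
    (hg : DifferentiableOn ℂ g (ball 0 R))
    (hfg : ∀ z ∈ ball (0 : ℂ) R, f z = (∏ i, (z - ρ i)) * g z) {z : ℂ} (hz : z ∈ ball (0 : ℂ) R)
    (hzρ : ∀ i, z ≠ ρ i) (hgz : g z ≠ 0) :
    f z ≠ 0 ∧ logDeriv f z = ∑ i, 1 / (z - ρ i) + logDeriv g z := by
  have hne (i : Fin N) : z - ρ i ≠ 0 := sub_ne_zero.2 (hzρ i)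
  have hprod : ∏ i, (z - ρ i) ≠ 0 := Finset.prod_ne_zero_iff.2 fun i _ ↦ hne i
  refine ⟨by rw [hfg z hz]; exact mul_ne_zero hprod hgz, ?_⟩
  have hev : f =ᶠ[𝓝 z] fun z ↦ (∏ i, (z - ρ i)) * g z := by
    filter_upwards [isOpen_ball.mem_nhds hz] with u hu using hfg u hu
  have h1 : logDeriv f z = logDeriv (fun z ↦ (∏ i, (z - ρ i)) * g z) z := by
    rw [logDeriv_apply, logDeriv_apply, hev.deriv_eq, hev.eq_of_nhds]
  rw [h1, logDeriv_mul (f := fun z ↦ ∏ i, (z - ρ i)) z hprod hgz (by fun_prop)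
    (hg.differentiableAt (isOpen_ball.mem_nhds hz)),
    logDeriv_prod (fun i _ ↦ hne i) (fun i _ ↦ by fun_prop)]
  congr 1
  refine Finset.sum_congr rfl fun i _ ↦ ?_
  rw [logDeriv_apply]
  simp

/-- Under the Riemann hypothesis, `ζ'/ζ` near `1/2 + iT` is the sum of `O(log T)` simple
fractions with poles on the critical line and a holomorphic function of size `O(log T)`. -/
theorem exists_logDeriv_riemannZeta_eq (RH : RiemannHypothesis) :
    ∃ C : ℝ, 0 < C ∧ ∀ T : ℝ, 20 ≤ T → ∃ (N : ℕ) (v : Fin N → ℝ) (e : ℂ → ℂ),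
      (N : ℝ) ≤ C * Real.log T ∧
      (∀ i, |v i| ≤ 5 / 2 ∧ riemannZeta (1 / 2 + (T + v i : ℝ) * Complex.I) = 0) ∧
      DifferentiableOn ℂ e (Set.Icc 0 1 ×ℂ Set.Icc (-2) 2) ∧
      (∀ w ∈ Set.Icc 0 1 ×ℂ Set.Icc (-2) 2, ‖e w‖ ≤ C * Real.log T) ∧
      ∀ w ∈ Set.Icc 0 1 ×ℂ Set.Icc (-2) 2, (∀ i, w ≠ v i * Complex.I) →
        riemannZeta (1 / 2 + T * Complex.I + w) ≠ 0 ∧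
        logDeriv riemannZeta (1 / 2 + T * Complex.I + w) =
          ∑ i, 1 / (w - v i * Complex.I) + e w := by
  obtain ⟨c, hc, hlow⟩ := exists_le_norm_riemannZeta
  obtain ⟨C₀, hC₀, hup⟩ := exists_norm_riemannZeta_le
  obtain ⟨C, hC, hfac⟩ := exists_local_factorization (r := 35 / 4) (R := 44 / 5) (R₀ := 89 / 10)
    (R₁ := 179 / 20) (by norm_num) (by norm_num) (by norm_num) (by norm_num)
  set κ := 1 + Real.log (2 * C₀) + |Real.log c| with hκ
  have hlogC₀ : 0 ≤ Real.log (2 * C₀) := Real.log_nonneg (by linarith)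
  have hκ1 : 1 ≤ κ := by linarith [abs_nonneg (Real.log c)]
  refine ⟨C * κ, by positivity, fun T hT ↦ ?_⟩
  have hlogT : 1 ≤ Real.log T := by
    rw [Real.le_log_iff_exp_le (by linarith)]
    linarith [Real.exp_one_lt_d9]
  set s₁ : ℂ := 9 + T * Complex.I with hs₁
  have hs₁re : s₁.re = 9 := by simp [hs₁]
  have hs₁im : s₁.im = T := by simp [hs₁]
  have hre {z : ℂ} {A : ℝ} (hz : ‖z‖ ≤ A) : 9 - A ≤ (s₁ + z).re := by
    rw [Complex.add_re, hs₁re]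
    linarith [(abs_le.1 (Complex.abs_re_le_norm z)).1]
  have him {z : ℂ} {A : ℝ} (hz : ‖z‖ ≤ A) : T - A ≤ (s₁ + z).im := by
    rw [Complex.add_im, hs₁im]
    linarith [(abs_le.1 (Complex.abs_im_le_norm z)).1]
  have hne1 {z : ℂ} (hz : ‖z‖ ≤ 179 / 20) : s₁ + z ≠ 1 := fun h ↦ by
    have := him hz
    rw [h, Complex.one_im] at this
    linarith
  obtain ⟨N, ρ, g, hρ, hρ0, hg, hfg, hgne, hN, hgb⟩ := hfac (fun z ↦ riemannZeta (s₁ + z))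
    (κ * Real.log T) (one_le_mul_of_one_le_of_one_le hκ1 hlogT)
    (fun z hz ↦ by
      have hz' : ‖z‖ ≤ 179 / 20 := by simpa using (mem_ball.1 hz).le
      exact ((differentiableAt_riemannZeta (hne1 hz')).comp z
        (by fun_prop)).differentiableWithinAt)
    (fun z hz ↦ by
      have hz' : ‖z‖ ≤ 89 / 10 := by simpa using hz
      have h1 := him hz'
      refine (hup (s₁ + z) (by linarith [hre hz']) (le_trans (by linarith) (le_abs_self _))).trans ?_
      have h2 : ‖s₁ + z‖ ≤ 2 * T := by
        have h3 : ‖s₁‖ ≤ 9 + T := by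
          refine (norm_add_le _ _).trans ?_
          rw [norm_mul, Complex.norm_I, Complex.norm_real, Real.norm_of_nonneg (by linarith)]
          simp
        linarith [norm_add_le s₁ z]
      have h4 : C₀ * ‖s₁ + z‖ ≤ Real.exp (Real.log (2 * C₀) + Real.log T) := by
        rw [Real.exp_add, Real.exp_log (by linarith), Real.exp_log (by linarith)]
        nlinarith
      refine h4.trans (Real.exp_le_exp.2 ?_)
      have h5 : 0 ≤ |Real.log c| := abs_nonneg _
      rw [hκ]
      nlinarith)
    (by
      rw [add_zero]
      refine le_trans ?_ (hlow s₁ (by rw [hs₁re]; norm_num))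
      rw [← Real.le_log_iff_exp_le hc]
      have h5 := neg_abs_le (Real.log c)
      have h6 : 0 ≤ |Real.log c| := abs_nonneg _
      rw [hκ]
      nlinarith)
  have hρre (i : Fin N) : (ρ i).re = -(17 / 2) := by
    have h := RH (s₁ + ρ i) (hρ0 i) (fun ⟨n, hn⟩ ↦ by
      have h1 := hre (hρ i)
      rw [hn] at h1
      have h2 : ((-2 * ((n : ℂ) + 1)).re) = -2 * ((n : ℝ) + 1) := by simp
      rw [h2] at h1
      have : (0 : ℝ) ≤ n := n.cast_nonneg
      linarith) (hne1 ((hρ i).trans (by norm_num)))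
    rw [Complex.add_re, hs₁re] at h
    linarith
  have hρeq (i : Fin N) : ρ i = -(17 / 2) + (ρ i).im * Complex.I := by
    apply Complex.ext <;> simp [hρre i]
  have hs₁' (w : ℂ) : s₁ + (w - 17 / 2) = 1 / 2 + T * Complex.I + w := by rw [hs₁]; ring
  have hmem {w : ℂ} (hw : w ∈ Set.Icc (0 : ℝ) 1 ×ℂ Set.Icc (-2 : ℝ) 2) :
      ‖w - 17 / 2‖ ≤ 35 / 4 := by
    rw [Complex.mem_reProdIm] at hw
    obtain ⟨⟨h1, h2⟩, h3, h4⟩ := hw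
    refine abs_le_of_sq_le_sq' ?_ (by norm_num) |>.2
    rw [← Complex.normSq_eq_norm_sq, Complex.normSq_apply]
    have e1 : (w - 17 / 2).re = w.re - 17 / 2 := by simp
    have e2 : (w - 17 / 2).im = w.im := by simp
    rw [e1, e2]
    nlinarith
  have hldg : DifferentiableOn ℂ (logDeriv g) (ball 0 (44 / 5)) := by
    have hsub : ball (0 : ℂ) (44 / 5) ⊆ ball 0 (179 / 20) := ball_subset_ball (by norm_num)
    exact ((hg.mono hsub).deriv isOpen_ball).div (hg.mono hsub)
      fun z hz ↦ hgne z (ball_subset_closedBall hz)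
  refine ⟨N, fun i ↦ (ρ i).im, fun w ↦ logDeriv g (w - 17 / 2), by rwa [mul_assoc],
    fun i ↦ ⟨?_, ?_⟩, ?_, fun w hw ↦ ?_, fun w hw hwv ↦ ?_⟩
  · refine abs_le_of_sq_le_sq ?_ (by norm_num)
    have h1 : ‖ρ i‖ ^ 2 ≤ (44 / 5) ^ 2 := by
      have := hρ i
      gcongr
    rw [← Complex.normSq_eq_norm_sq, Complex.normSq_apply, hρre i] at h1
    nlinarith
  · have h := hρ0 i
    rw [hρeq i] at h
    convert h using 2
    rw [hs₁]
    simp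
    ring
  · refine hldg.comp (by fun_prop) fun w hw ↦ ?_
    rw [mem_ball, dist_zero_right]
    exact (hmem hw).trans_lt (by norm_num)
  · rw [mul_assoc]
    exact hgb _ (by rw [mem_closedBall, dist_zero_right]; exact hmem hw)
  · have hzb : w - 17 / 2 ∈ ball (0 : ℂ) (179 / 20) := by
      rw [mem_ball, dist_zero_right]
      exact (hmem hw).trans_lt (by norm_num)
    have hsubρ (i : Fin N) : w - 17 / 2 - ρ i = w - (ρ i).im * Complex.I := by
      nth_rewrite 1 [hρeq i]
      ring
    have h := logDeriv_eq_sum_add hg hfg hzb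
      (fun i ↦ sub_ne_zero.1 (by rw [hsubρ]; exact sub_ne_zero.2 (hwv i)))
      (hgne _ (by
        rw [mem_closedBall, dist_zero_right]
        exact (hmem hw).trans (by norm_num)))
    simp only [hsubρ, logDeriv_apply (f := fun z ↦ riemannZeta (s₁ + z)),
      deriv_comp_const_add, hs₁'] at h
    exact h

end PartialFractions

section Gap

open MeasureTheory

lemma abs_log_add_sub_log_le {T y : ℝ} (hT : 4 ≤ T) (hy : |y| ≤ 2) :
    |Real.log (T + y) - Real.log T| ≤ 1 := by
  rw [abs_le] at hy
  have hT0 : 0 < T := by linarith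
  have hTy : 0 < T + y := by linarith [hy.1]
  rw [← Real.log_div hTy.ne' hT0.ne']
  have h1 := Real.log_le_sub_one_of_pos (div_pos hTy hT0)
  have h2 := Real.one_sub_inv_le_log_of_pos (div_pos hTy hT0)
  have h3 : (T + y) / T ≤ 2 := by rw [div_le_iff₀ hT0]; linarith [hy.2]
  have h4 : ((T + y) / T)⁻¹ ≤ 2 := by
    rw [inv_div, div_le_iff₀ hTy]; linarith [hy.1]
  rw [abs_le]
  constructor <;> linarith

/-- The averaged form of `Re ζ'/ζ = -½ log t + O(1)` after removal of the poles. -/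
lemma integral_re_mul_gapKernelIm_le {C T a : ℝ} {N : ℕ} {v : Fin N → ℝ} {e : ℂ → ℂ}
    (hC : ∀ t : ℝ, 2 ≤ t → riemannZeta (1 / 2 + t * Complex.I) ≠ 0 →
      |(logDeriv riemannZeta (1 / 2 + t * Complex.I)).re + Real.log t / 2| ≤ C)
    (hT : 4 ≤ T) (ha : 80 ≤ a)
    (he : DifferentiableOn ℂ e (Set.Icc 0 1 ×ℂ Set.Icc (-2) 2))
    (hev : ∀ w ∈ Set.Icc 0 1 ×ℂ Set.Icc (-2) 2, (∀ i, w ≠ v i * Complex.I) →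
        riemannZeta (1 / 2 + T * Complex.I + w) ≠ 0 ∧
        logDeriv riemannZeta (1 / 2 + T * Complex.I + w) =
          ∑ i, 1 / (w - v i * Complex.I) + e w) :
    (∫ y in (-2 : ℝ)..2, e (y * Complex.I) * gapKernel a (y * Complex.I)).re ≤
      (34 * Real.pi * (C + 1) - Real.log T) / a ^ 3 := by
  have ha0 : 0 < a := by linarith
  have hmem {y : ℝ} (hy : y ∈ Set.Icc (-2 : ℝ) 2) :
      (y * Complex.I : ℂ) ∈ Set.Icc (0 : ℝ) 1 ×ℂ Set.Icc (-2 : ℝ) 2 := by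
    rw [Complex.mem_reProdIm]
    simpa using hy
  have hec : ContinuousOn (fun y : ℝ ↦ e (y * Complex.I)) (Set.Icc (-2) 2) :=
    he.continuousOn.comp (by fun_prop) fun y hy ↦ hmem hy
  have hKc := continuous_gapKernelIm a
  have h_int : IntervalIntegrable (fun y : ℝ ↦ e (y * Complex.I) * gapKernel a (y * Complex.I))
      volume (-2) 2 := by
    refine ContinuousOn.intervalIntegrable_of_Icc (by norm_num) (hec.mul ?_)
    simp only [gapKernel_mul_I]
    exact (Complex.continuous_ofReal.comp hKc).continuousOn
  have hre (y : ℝ) : (e (y * Complex.I) * gapKernel a (y * Complex.I)).re =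
      (e (y * Complex.I)).re * gapKernelIm a y := by
    rw [gapKernel_mul_I, Complex.re_mul_ofReal]
  rw [re_intervalIntegral h_int]
  simp only [hre]
  have hpt : ∀ᵐ y ∂(volume : Measure ℝ), y ∈ Set.Icc (-2 : ℝ) 2 →
      (e (y * Complex.I)).re * gapKernelIm a y ≤
        (C + 1) * |gapKernelIm a y| - Real.log T / 2 * gapKernelIm a y := by
    filter_upwards [(Set.finite_range v).countable.ae_notMem volume] with y hy hy2
    have hne (i : Fin N) : (y * Complex.I : ℂ) ≠ v i * Complex.I := fun h ↦ hy ⟨i, by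
      have := mul_right_cancel₀ Complex.I_ne_zero h
      exact_mod_cast this.symm⟩
    obtain ⟨h0, hl⟩ := hev _ (hmem hy2) hne
    have hsum : (∑ i, 1 / ((y * Complex.I : ℂ) - v i * Complex.I)).re = 0 := by
      rw [Complex.re_sum]
      refine Finset.sum_eq_zero fun i _ ↦ ?_
      rw [one_div, Complex.inv_re]
      simp
    have hs : (1 / 2 + T * Complex.I + y * Complex.I : ℂ) =
        1 / 2 + ((T + y : ℝ) : ℂ) * Complex.I := by push_cast; ring
    have hl' := congrArg Complex.re hl
    rw [Complex.add_re, hsum, zero_add, hs] at hl'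
    rw [hs] at h0
    have h1 := hC (T + y) (by linarith [hy2.1]) h0
    rw [hl'] at h1
    have h2 := abs_log_add_sub_log_le hT (abs_le.2 hy2)
    have h3 : |(e (y * Complex.I)).re + Real.log T / 2| ≤ C + 1 := by
      rw [abs_le] at h1 h2 ⊢
      constructor <;> linarith [h1.1, h1.2, h2.1, h2.2]
    have h4 : ((e (y * Complex.I)).re + Real.log T / 2) * gapKernelIm a y ≤
        (C + 1) * |gapKernelIm a y| := by
      refine (le_abs_self _).trans ?_
      rw [abs_mul]
      gcongr
    linarith
  have hstep : ∫ y in (-2 : ℝ)..2, (e (y * Complex.I)).re * gapKernelIm a y ≤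
      ∫ y in (-2 : ℝ)..2, ((C + 1) * |gapKernelIm a y| - Real.log T / 2 * gapKernelIm a y) := by
    refine intervalIntegral.integral_mono_ae_restrict (by norm_num) ?_ ?_ ?_
    · exact ContinuousOn.intervalIntegrable_of_Icc (by norm_num)
        ((Complex.continuous_re.comp_continuousOn hec).mul hKc.continuousOn)
    · exact Continuous.intervalIntegrable (by fun_prop) _ _
    · exact (ae_restrict_iff' measurableSet_Icc).2 hpt
  refine hstep.trans ?_
  rw [intervalIntegral.integral_sub (Continuous.intervalIntegrable (by fun_prop) _ _)
    (Continuous.intervalIntegrable (by fun_prop) _ _), intervalIntegral.integral_const_mul,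
    intervalIntegral.integral_const_mul]
  have hC0 : 0 ≤ C + 1 := by
    obtain ⟨y, hy, hyv⟩ : ∃ y ∈ Set.Icc (-2 : ℝ) 2, y ∉ Set.range v :=
      ((Set.Icc_infinite (by norm_num)).sdiff (Set.finite_range v)).nonempty
    have h0 := (hev _ (hmem hy) fun i h ↦ hyv ⟨i, by
      have := mul_right_cancel₀ Complex.I_ne_zero h
      exact_mod_cast this.symm⟩).1
    have hs : (1 / 2 + T * Complex.I + y * Complex.I : ℂ) =
        1 / 2 + ((T + y : ℝ) : ℂ) * Complex.I := by push_cast; ring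
    rw [hs] at h0
    linarith [(abs_nonneg _).trans (hC (T + y) (by linarith [hy.1]) h0)]
  have i1 := mul_le_mul_of_nonneg_left (integral_abs_gapKernelIm_le ha0) hC0
  have i2 := mul_le_mul_of_nonneg_left (le_integral_gapKernelIm ha)
    (div_nonneg (Real.log_nonneg (by linarith : 1 ≤ T)) zero_le_two)
  have e1 : (34 * Real.pi * (C + 1) - Real.log T) / a ^ 3 =
      (C + 1) * (34 * Real.pi / a ^ 3) - Real.log T / 2 * (2 / a ^ 3) := by ring
  linarith

/-- If no ordinate lies within `4 / a` of `T`, then `log T` is bounded in terms of `a`. -/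
theorem exists_log_le_of_no_zeros (RH : RiemannHypothesis) :
    ∃ C : ℝ, 0 < C ∧ ∀ T a : ℝ, 20 ≤ T → 80 ≤ a →
      (∀ γ : ℝ, riemannZeta (1 / 2 + γ * Complex.I) = 0 → 4 / a ≤ |γ - T|) →
      Real.log T ≤ C * (1 + a ^ 3 * (Real.exp (12 * a) + Real.log T * Real.exp (-(4 * a)))) := by
  obtain ⟨C₁, hC₁, hline⟩ := exists_abs_re_logDeriv_riemannZeta_le
  obtain ⟨C₂, hC₂, hG⟩ := exists_norm_logDeriv_riemannZeta_le
  obtain ⟨C₃, hC₃, hfac⟩ := exists_logDeriv_riemannZeta_eq RH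
  refine ⟨34 * Real.pi * (C₁ + 1) + 8 * C₂ + 16 * C₃, by positivity, fun T a hT ha hgap ↦ ?_⟩
  have ha0 : 0 < a := by linarith
  obtain ⟨N, v, e, hN, hv, he, heM, hev⟩ := hfac T hT
  set K := gapKernel a with hKdef
  set ε := 2 * Real.exp (-(4 * a)) with hε
  have hK : Differentiable ℂ K := differentiable_gapKernel a
  have hKε (w : ℂ) (h0 : 0 ≤ w.re) (h1 : w.re ≤ 1) (h2 : 2 ≤ |w.im|) : ‖K w‖ ≤ ε := by
    have hw : 1 ≤ ‖w‖ := by linarith [Complex.abs_im_le_norm w]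
    refine (norm_gapKernel_le (by linarith) h0 h1 hw).trans ?_
    rw [hε]
    gcongr
    have : 4 ≤ w.im ^ 2 := by rw [← sq_abs]; nlinarith
    nlinarith
  have hre1 (y : ℝ) : (1 + y * Complex.I : ℂ).re = 1 := by simp
  have hK1 (y : ℝ) : ‖K (1 + y * Complex.I)‖ ≤ 2 * Real.exp (12 * a) := by
    refine (norm_gapKernel_le (by linarith) (by simp) (by simp) ?_).trans ?_
    · refine le_trans ?_ (Complex.abs_re_le_norm _)
      rw [hre1, abs_one]
    · gcongr
      have : 0 ≤ 4 * a * (1 + y * Complex.I : ℂ).im ^ 2 := by positivity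
      linarith
  have hmem1 {y : ℝ} (hy : y ∈ Set.Icc (-2 : ℝ) 2) :
      (1 + y * Complex.I : ℂ) ∈ Set.Icc (0 : ℝ) 1 ×ℂ Set.Icc (-2 : ℝ) 2 := by
    rw [Complex.mem_reProdIm]
    simpa using hy
  have hpole (i : Fin N) := re_integral_div_le hK (gapKernel_mul_I a) hKε (hv i).1
    (gapKernelIm_nonpos ha0 (by simpa using hgap _ (hv i).2))
  have hshift := norm_integral_mul_sub_le hK zero_le_two hKε he heM
  have hupper := integral_re_mul_gapKernelIm_le hline (by linarith : 4 ≤ T) ha he hev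
  have hne1 (y : ℝ) (i : Fin N) : (1 + y * Complex.I : ℂ) - v i * Complex.I ≠ 0 := fun h ↦ by
    have := congrArg Complex.re h
    simp at this
  have hKc : Continuous fun y : ℝ ↦ K (1 + y * Complex.I) := hK.continuous.comp (by fun_prop)
  have hpc (i : Fin N) :
      Continuous fun y : ℝ ↦ K (1 + y * Complex.I) / (1 + y * Complex.I - v i * Complex.I) :=
    hKc.div (by fun_prop) fun y ↦ hne1 y i
  have hec : ContinuousOn (fun y : ℝ ↦ e (1 + y * Complex.I)) (Set.Icc (-2) 2) :=
    he.continuousOn.comp (by fun_prop) fun y hy ↦ hmem1 hy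
  have hei : IntervalIntegrable (fun y : ℝ ↦ e (1 + y * Complex.I) * K (1 + y * Complex.I))
      volume (-2) 2 :=
    ContinuousOn.intervalIntegrable_of_Icc (by norm_num) (hec.mul hKc.continuousOn)
  have hsplit : ∫ y in (-2 : ℝ)..2, (∑ i, K (1 + y * Complex.I) /
      (1 + y * Complex.I - v i * Complex.I) + e (1 + y * Complex.I) * K (1 + y * Complex.I)) =
      ∑ i, (∫ y in (-2 : ℝ)..2, K (1 + y * Complex.I) /
        (1 + y * Complex.I - v i * Complex.I)) +
      ∫ y in (-2 : ℝ)..2, e (1 + y * Complex.I) * K (1 + y * Complex.I) := by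
    rw [intervalIntegral.integral_add _ hei, intervalIntegral.integral_finsetSum]
    · exact fun i _ ↦ (hpc i).intervalIntegrable _ _
    · exact (continuous_finsetSum _ fun i _ ↦ hpc i).intervalIntegrable _ _
  have htotal : ‖∫ y in (-2 : ℝ)..2, (∑ i, K (1 + y * Complex.I) /
      (1 + y * Complex.I - v i * Complex.I) + e (1 + y * Complex.I) * K (1 + y * Complex.I))‖ ≤
      C₂ * (2 * Real.exp (12 * a)) * |2 - (-2)| := by
    refine intervalIntegral.norm_integral_le_of_norm_le_const fun y hy ↦ ?_
    rw [Set.uIoc_of_le (by norm_num)] at hy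
    have hl := (hev _ (hmem1 ⟨hy.1.le, hy.2⟩) fun i ↦ sub_ne_zero.1 (hne1 y i)).2
    have hfact : ∑ i, K (1 + y * Complex.I) / (1 + y * Complex.I - v i * Complex.I) +
        e (1 + y * Complex.I) * K (1 + y * Complex.I) =
        logDeriv riemannZeta (1 / 2 + T * Complex.I + (1 + y * Complex.I)) *
          K (1 + y * Complex.I) := by
      rw [hl, add_mul, Finset.sum_mul]
      simp only [one_div_mul_eq_div]
    rw [hfact, norm_mul]
    gcongr
    · refine hG _ ?_
      simp
      norm_num
    · exact hK1 y
  rw [hsplit] at htotal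
  have h1 := (abs_le.1 ((Complex.abs_re_le_norm _).trans htotal)).1
  have h2 := (abs_le.1 ((Complex.abs_re_le_norm _).trans hshift)).2
  rw [Complex.add_re, Complex.re_sum] at h1
  rw [Complex.sub_re] at h2
  have h3 := Finset.sum_le_sum fun i (_ : i ∈ Finset.univ) ↦ hpole i
  rw [Finset.sum_const, Finset.card_univ, Fintype.card_fin, nsmul_eq_mul] at h3
  have h4 : |(2 : ℝ) - (-2)| = 4 := by norm_num
  rw [h4] at h1
  have hε0 : 0 ≤ ε := by positivity
  have h5 : (N : ℝ) * (6 * ε) ≤ C₃ * Real.log T * (6 * ε) := by gcongr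
  have h6 : -(8 * C₂ * Real.exp (12 * a) + 16 * C₃ * (Real.log T * Real.exp (-(4 * a)))) ≤
      (34 * Real.pi * (C₁ + 1) - Real.log T) / a ^ 3 := by
    have e1 : C₃ * Real.log T * (6 * ε) + 2 * (C₃ * Real.log T * ε) =
        16 * C₃ * (Real.log T * Real.exp (-(4 * a))) := by rw [hε]; ring
    linarith
  rw [le_div_iff₀ (by positivity)] at h6
  have hlog : 0 ≤ Real.log T := Real.log_nonneg (by linarith)
  have p1 : 0 ≤ a ^ 3 * Real.exp (12 * a) := by positivity
  have p2 : 0 ≤ a ^ 3 * (Real.log T * Real.exp (-(4 * a))) := by positivity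
  have p3 : 0 < 34 * Real.pi * (C₁ + 1) := by positivity
  generalize 34 * Real.pi * (C₁ + 1) = B at *
  calc Real.log T ≤ B + 8 * C₂ * (a ^ 3 * Real.exp (12 * a)) +
        16 * C₃ * (a ^ 3 * (Real.log T * Real.exp (-(4 * a)))) := by linarith
    _ ≤ (B + 8 * C₂ + 16 * C₃) * 1 + (B + 8 * C₂ + 16 * C₃) * (a ^ 3 * Real.exp (12 * a)) +
        (B + 8 * C₂ + 16 * C₃) * (a ^ 3 * (Real.log T * Real.exp (-(4 * a)))) := by
        gcongr <;> linarith
    _ = _ := by ring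

lemma eventually_mul_one_add_lt_exp (C : ℝ) :
    ∀ᶠ a : ℝ in atTop, C * (1 + a ^ 3 * (3 * Real.exp (12 * a))) < Real.exp (16 * a) := by
  have h1 : Tendsto (fun a : ℝ ↦ C * (Real.exp (-(16 * a)) + 3 * (a ^ 3 * Real.exp (-(4 * a)))))
      atTop (𝓝 (C * (0 + 3 * 0))) := by
    refine Tendsto.const_mul _ (Tendsto.add ?_ (Tendsto.const_mul _ ?_))
    · exact Real.tendsto_exp_neg_atTop_nhds_zero.comp
        (tendsto_id.const_mul_atTop (by norm_num : (0 : ℝ) < 16))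
    · have h := (Real.tendsto_pow_mul_exp_neg_atTop_nhds_zero 3).comp
        (tendsto_id.const_mul_atTop (by norm_num : (0 : ℝ) < 4))
      have h' := h.const_mul (1 / 64)
      rw [mul_zero] at h'
      refine h'.congr fun a ↦ ?_
      simp only [Function.comp, id]
      ring
  rw [mul_zero, add_zero, mul_zero] at h1
  filter_upwards [h1.eventually_lt_const one_pos] with a ha
  have h2 := mul_lt_mul_of_pos_right ha (Real.exp_pos (16 * a))
  have e1 : Real.exp (-(16 * a)) * Real.exp (16 * a) = 1 := by
    rw [← Real.exp_add]; simp
  have e2 : Real.exp (-(4 * a)) * Real.exp (16 * a) = Real.exp (12 * a) := by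
    rw [← Real.exp_add]; ring_nf
  calc _ = C * (Real.exp (-(16 * a)) * Real.exp (16 * a) +
        3 * (a ^ 3 * (Real.exp (-(4 * a)) * Real.exp (16 * a)))) := by rw [e1, e2]; ring
    _ = C * (Real.exp (-(16 * a)) + 3 * (a ^ 3 * Real.exp (-(4 * a)))) * Real.exp (16 * a) := by
        ring
    _ < _ := by linarith

end Gap

/-- Littlewood's gap estimate: on RH there is `A > 0` such that every sufficiently large
ordinate `γ'` of a zero of `ζ` on the critical line is followed by another such ordinate
`γ''` with `γ' < γ'' < γ' + A/ln ln γ'`. -/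
theorem littlewood_gap (RH : RiemannHypothesis) :
    ∃ A > (0:ℝ), ∀ᶠ γ' : ℝ in Filter.atTop, riemannZeta (1/2 + Complex.I * γ') = 0 →
      ∃ γ'' : ℝ, γ' < γ'' ∧ γ'' < γ' + A / Real.log (Real.log γ') ∧
        riemannZeta (1/2 + Complex.I * γ'') = 0 := by
  obtain ⟨C, hC, hlog⟩ := exists_log_le_of_no_zeros RH
  refine ⟨128, by norm_num, ?_⟩
  have hlim : Tendsto (fun γ : ℝ ↦ Real.log (Real.log γ) / 16) atTop atTop :=
    (Real.tendsto_log_atTop.comp Real.tendsto_log_atTop).atTop_div_const (by norm_num)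
  filter_upwards [hlim.eventually (eventually_mul_one_add_lt_exp C),
    hlim.eventually_ge_atTop 80, eventually_ge_atTop 20,
    Real.tendsto_log_atTop.eventually_ge_atTop 1] with γ h1 ha hγ hL _
  set a := Real.log (Real.log γ) / 16 with hadef
  have ha0 : 0 < a := by linarith
  have hll : Real.log (Real.log γ) = 16 * a := by rw [hadef]; ring
  have hexp : Real.exp (16 * a) = Real.log γ := by rw [← hll, Real.exp_log (by linarith)]
  have hδ : 0 < 4 / a := by positivity
  have hδ1 : 4 / a ≤ 1 := by rw [div_le_one ha0]; linarith
  by_contra! hno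
  have hT := hlog (γ + 4 / a) a (by linarith) ha fun t ht ↦ by
    by_contra! hlt
    rw [abs_lt] at hlt
    refine hno t (by linarith [hlt.1]) ?_ (by rwa [mul_comm Complex.I])
    have e : 128 / Real.log (Real.log γ) = 4 / a + 4 / a := by rw [hll]; field_simp; norm_num
    rw [e]
    linarith [hlt.2]
  have hle : Real.log γ ≤ Real.log (γ + 4 / a) := Real.log_le_log (by linarith) (by linarith)
  have hle2 : Real.log (γ + 4 / a) ≤ 2 * Real.log γ := by
    have h := (abs_le.1 (abs_log_add_sub_log_le (T := γ) (y := 4 / a) (by linarith)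
      (by rw [abs_of_pos hδ]; linarith))).2
    linarith
  have e2 : Real.log γ * Real.exp (-(4 * a)) = Real.exp (12 * a) := by
    rw [← hexp, ← Real.exp_add]; ring_nf
  have h3 : Real.log (γ + 4 / a) * Real.exp (-(4 * a)) ≤ 2 * Real.exp (12 * a) := by
    rw [← e2, ← mul_assoc]
    gcongr
  have h4 : C * (1 + a ^ 3 * (Real.exp (12 * a) + Real.log (γ + 4 / a) * Real.exp (-(4 * a)))) ≤
      C * (1 + a ^ 3 * (3 * Real.exp (12 * a))) := by
    gcongr
    linarith
  rw [hexp] at h1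
  linarith
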